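/- arXiv:2603.00673 — 2 statements merged into one kernel-verified Lean document; each statement's English description precedes it below -/
import Mathlib

section
/- Murakami's formula: for any nonnegative integers r and s, T(r,s) = ∑_{k=1}^{r+s+1} (-1)^{k-1} · [C(2k, 2r+1) + (1 - 1/2^{2k})·C(2k, 2s+1)] · (1/2^{2k}) · ζ(2k+1) · t({2}^{r+s+1-k}). -/
/-- The multiple zeta value `ζ(s₁,…,s_l) = ∑_{1 ≤ k₁ < ⋯ < k_l} ∏ 1/kᵢ^{sᵢ}`. -/
noncomputable def MZV (s : List ℕ) : ℝ :=
  ∑' f : {f : Fin s.length → ℕ+ // StrictMono f},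
    ∏ i : Fin s.length, (1 : ℝ) / ((f.1 i : ℕ) : ℝ) ^ s.get i

/-- The multiple t-value `t(s₁,…,s_l) = ∑_{1 ≤ k₁ < ⋯ < k_l} ∏ 1/(2kᵢ-1)^{sᵢ}`. -/
noncomputable def MTV (s : List ℕ) : ℝ :=
  ∑' f : {f : Fin s.length → ℕ+ // StrictMono f},
    ∏ i : Fin s.length, (1 : ℝ) / ((2 * (f.1 i : ℕ) - 1 : ℕ) : ℝ) ^ s.get i

open Real Filter Topology MeasureTheory intervalIntegral Finset

/-- `∫₀^{π/2} sin^{2m+1}`, in product form. -/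
noncomputable def wallis (m : ℕ) : ℝ :=
  ∏ i ∈ range m, (2 * i + 2 : ℝ) / (2 * i + 3)

/-- The odd power `sin^{2m+1}` normalised to have integral `1` on `[0, π/2]`. -/
noncomputable def sinKernel (m : ℕ) (θ : ℝ) : ℝ :=
  sin θ ^ (2 * m + 1) / wallis m

/-- The twofold primitive of `f` that vanishes to second order at `0`. -/
noncomputable def doublePrimitive (f : ℝ → ℝ) (θ : ℝ) : ℝ :=
  ∫ φ in (0 : ℝ)..θ, ∫ ψ in (0 : ℝ)..φ, f ψ

/-- The remainder after `m` terms of the expansion of `θ^{2r+1}/(2r+1)!` in odd powers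
of `sin θ`, up to lower-order corrections. -/
noncomputable def arcsinTail : ℕ → ℕ → ℝ → ℝ
  | 0, m => fun θ => θ - ∑ k ∈ range m, sinKernel k θ / (2 * k + 1) ^ 2
  | r + 1, m => doublePrimitive (arcsinTail r m)

lemma wallis_pos (m : ℕ) : 0 < wallis m := prod_pos fun _ _ => by positivity

lemma wallis_succ (m : ℕ) : wallis (m + 1) = wallis m * ((2 * m + 2) / (2 * m + 3)) :=
  prod_range_succ _ _

lemma one_le_wallis_sq_mul (m : ℕ) : 1 ≤ wallis m ^ 2 * (2 * m + 1) := by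
  induction m with
  | zero => simp [wallis]
  | succ m ih =>
    refine ih.trans ?_
    have hw := wallis_pos m
    have : wallis (m + 1) ^ 2 * (2 * (m + 1 : ℕ) + 1) =
        wallis m ^ 2 * ((2 * m + 2) ^ 2 / (2 * m + 3)) := by
      rw [wallis_succ]; push_cast; field_simp; ring
    rw [this]
    refine mul_le_mul_of_nonneg_left ?_ (by positivity)
    rw [le_div_iff₀ (by positivity)]
    nlinarith

lemma tendsto_inv_mul_wallis :
    Tendsto (fun m : ℕ => 1 / ((2 * m + 2) * wallis m)) atTop (𝓝 0) := by
  have hlim : Tendsto (fun m : ℕ => √(1 / ((m : ℝ) + 1))) atTop (𝓝 0) := by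
    simpa using (tendsto_one_div_add_atTop_nhds_zero_nat (𝕜 := ℝ)).sqrt
  refine squeeze_zero (fun m => ?_) (fun m => ?_) hlim
  · have := wallis_pos m; positivity
  · have hw := wallis_pos m
    apply Real.le_sqrt_of_sq_le
    rw [div_pow, one_pow]
    apply one_div_le_one_div_of_le (by positivity)
    have := one_le_wallis_sq_mul m
    have h2 : ((2 * m + 2) * wallis m) ^ 2 =
      (wallis m ^ 2 * (2 * m + 1)) * (2 * m + 2) + wallis m ^ 2 * (2 * m + 2) := by ring
    rw [h2]
    nlinarith [mul_le_mul_of_nonneg_right this (by positivity : (0 : ℝ) ≤ 2 * m + 2),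
      (by positivity : 0 ≤ wallis m ^ 2 * (2 * m + 2))]

lemma continuous_sinKernel (m : ℕ) : Continuous (sinKernel m) := by
  unfold sinKernel; fun_prop

lemma continuous_primitive_of_continuous {f : ℝ → ℝ} (hf : Continuous f) (a : ℝ) :
    Continuous fun θ => ∫ φ in a..θ, f φ :=
  continuous_primitive (fun _ _ => hf.intervalIntegrable _ _) a

lemma continuous_doublePrimitive {f : ℝ → ℝ} (hf : Continuous f) :
    Continuous (doublePrimitive f) :=
  continuous_primitive_of_continuous (continuous_primitive_of_continuous hf 0) 0

lemma continuous_arcsinTail (r m : ℕ) : Continuous (arcsinTail r m) := by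
  induction r with
  | zero =>
    have := continuous_sinKernel
    unfold arcsinTail
    fun_prop
  | succ r ih => exact continuous_doublePrimitive ih

lemma doublePrimitive_sub {f g : ℝ → ℝ} (hf : Continuous f) (hg : Continuous g) (θ : ℝ) :
    doublePrimitive (fun x => f x - g x) θ = doublePrimitive f θ - doublePrimitive g θ := by
  unfold doublePrimitive
  rw [← integral_sub ((continuous_primitive_of_continuous hf 0).intervalIntegrable _ _)
    ((continuous_primitive_of_continuous hg 0).intervalIntegrable _ _)]
  congr 1; ext φ
  exact integral_sub (hf.intervalIntegrable _ _) (hg.intervalIntegrable _ _)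

lemma doublePrimitive_div_const (f : ℝ → ℝ) (a θ : ℝ) :
    doublePrimitive (fun x => f x / a) θ = doublePrimitive f θ / a := by
  simp [doublePrimitive]

lemma integral_sinKernel_sub (m : ℕ) (θ : ℝ) :
    ∫ φ in (0 : ℝ)..θ, (sinKernel m φ - sinKernel (m + 1) φ) =
      sin θ ^ (2 * m + 2) * cos θ / ((2 * m + 3) * wallis (m + 1)) := by
  have hd : ∀ x : ℝ, HasDerivAt
      (fun θ => sin θ ^ (2 * m + 2) * cos θ / ((2 * m + 3) * wallis (m + 1)))
      (sinKernel m x - sinKernel (m + 1) x) x := by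
    intro x
    have hw := wallis_pos m
    have h := ((((hasDerivAt_sin x).pow (2 * m + 2)).mul (hasDerivAt_cos x)).div_const
      ((2 * m + 3) * wallis (m + 1)))
    refine h.congr_deriv ?_
    simp only [sinKernel, wallis_succ]
    have e : cos x ^ 2 = 1 - sin x ^ 2 := cos_sq' x
    simp only [Pi.pow_apply, show 2 * m + 2 - 1 = 2 * m + 1 by omega]
    push_cast
    field_simp
    rw [show sin x ^ (2 * (m + 1) + 1) = sin x ^ (2 * m + 1) * sin x ^ 2 by ring,
      show sin x ^ (2 * m + 2) = sin x ^ (2 * m + 1) * sin x by ring]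
    rw [e]; ring
  rw [integral_eq_sub_of_hasDerivAt (fun x _ => hd x)]
  · simp
  · exact ((continuous_sinKernel m).sub (continuous_sinKernel _)).intervalIntegrable _ _

lemma integral_sinKernel (m : ℕ) : ∫ φ in (0 : ℝ)..(π / 2), sinKernel m φ = 1 := by
  induction m with
  | zero => simp [sinKernel, wallis]
  | succ m ih =>
    have h := integral_sinKernel_sub m (π / 2)
    rw [integral_sub ((continuous_sinKernel m).intervalIntegrable _ _)
      ((continuous_sinKernel _).intervalIntegrable _ _), ih] at h
    simp at h
    linarith

lemma doublePrimitive_sinKernel_sub (m : ℕ) (θ : ℝ) :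
    doublePrimitive (sinKernel m) θ - doublePrimitive (sinKernel (m + 1)) θ =
      sinKernel (m + 1) θ / (2 * m + 3) ^ 2 := by
  rw [← doublePrimitive_sub (continuous_sinKernel m) (continuous_sinKernel _)]
  unfold doublePrimitive
  simp_rw [integral_sinKernel_sub]
  have hd : ∀ x : ℝ, HasDerivAt (fun θ => sinKernel (m + 1) θ / (2 * m + 3) ^ 2)
      (sin x ^ (2 * m + 2) * cos x / ((2 * m + 3) * wallis (m + 1))) x := by
    intro x
    have hw := wallis_pos (m + 1)
    have h := ((((hasDerivAt_sin x).pow (2 * (m + 1) + 1)).div_const (wallis (m + 1))).div_const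
      ((2 * m + 3 : ℝ) ^ 2))
    refine h.congr_deriv ?_
    push_cast
    rw [show 2 * (m + 1) = 2 * m + 2 by ring]
    field_simp
    ring
  rw [integral_eq_sub_of_hasDerivAt (fun x _ => hd x)]
  · simp [sinKernel]
  · apply Continuous.intervalIntegrable; fun_prop

lemma doublePrimitive_sinKernel (m : ℕ) :
    doublePrimitive (sinKernel m) = arcsinTail 0 (m + 1) := by
  induction m with
  | zero =>
    ext θ
    simp [doublePrimitive, arcsinTail, sinKernel, wallis]
  | succ m ih =>
    ext θ
    have h := doublePrimitive_sinKernel_sub m θ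
    rw [ih] at h
    simp only [arcsinTail, sum_range_succ _ (m + 1)] at h ⊢
    push_cast
    rw [show (2 * ((m : ℝ) + 1) + 1) = 2 * m + 3 by ring]
    linarith

lemma arcsinTail_zero_sub (m : ℕ) (θ : ℝ) :
    arcsinTail 0 m θ - arcsinTail 0 (m + 1) θ = sinKernel m θ / (2 * m + 1) ^ 2 := by
  simp only [arcsinTail, sum_range_succ]; ring

lemma arcsinTail_succ_sub (r m : ℕ) (θ : ℝ) :
    arcsinTail (r + 1) m θ - arcsinTail (r + 1) (m + 1) θ =
      arcsinTail r (m + 1) θ / (2 * m + 1) ^ 2 := by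
  induction r generalizing θ with
  | zero =>
    change doublePrimitive _ θ - doublePrimitive _ θ = _
    rw [← doublePrimitive_sub (continuous_arcsinTail _ _) (continuous_arcsinTail _ _)]
    simp_rw [arcsinTail_zero_sub]
    rw [doublePrimitive_div_const, doublePrimitive_sinKernel]
  | succ r ih =>
    change doublePrimitive _ θ - doublePrimitive _ θ = _
    rw [← doublePrimitive_sub (continuous_arcsinTail _ _) (continuous_arcsinTail _ _)]
    simp_rw [ih]
    rw [doublePrimitive_div_const]
    rfl

lemma arcsinTail_at_zero (r : ℕ) (θ : ℝ) :
    arcsinTail r 0 θ = θ ^ (2 * r + 1) / (2 * r + 1).factorial := by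
  induction r generalizing θ with
  | zero => simp [arcsinTail]
  | succ r ih =>
    simp only [arcsinTail, doublePrimitive, ih, intervalIntegral.integral_div, integral_pow]
    rw [show 2 * (r + 1) + 1 = 2 * r + 1 + 1 + 1 by ring, Nat.factorial_succ (2 * r + 1 + 1),
      Nat.factorial_succ (2 * r + 1)]
    simp [integral_pow]
    field_simp

lemma sin_nonneg_of_mem {θ : ℝ} (h : θ ∈ Set.Icc 0 (π / 2)) : 0 ≤ sin θ :=
  sin_nonneg_of_nonneg_of_le_pi h.1 (by linarith [h.2, pi_pos])

lemma sinKernel_nonneg (m : ℕ) {θ : ℝ} (h : θ ∈ Set.Icc 0 (π / 2)) : 0 ≤ sinKernel m θ :=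
  div_nonneg (pow_nonneg (sin_nonneg_of_mem h) _) (wallis_pos m).le

lemma integral_mono_bound {f : ℝ → ℝ} (hf : Continuous f) {c : ℝ}
    (h0 : ∀ x ∈ Set.Icc 0 c, 0 ≤ f x) (hm : MonotoneOn f (Set.Icc 0 c)) :
    (∀ x ∈ Set.Icc 0 c, 0 ≤ ∫ t in (0 : ℝ)..x, f t) ∧
    MonotoneOn (fun x => ∫ t in (0 : ℝ)..x, f t) (Set.Icc 0 c) ∧
    ∀ x ∈ Set.Icc 0 c, ∫ t in (0 : ℝ)..x, f t ≤ x * f x := by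
  refine ⟨fun x hx => integral_nonneg hx.1 fun t ht => h0 t ⟨ht.1, ht.2.trans hx.2⟩, ?_, ?_⟩
  · intro x hx y hy hxy
    have h := integral_add_adjacent_intervals (hf.intervalIntegrable (μ := volume) 0 x)
      (hf.intervalIntegrable x y)
    have : 0 ≤ ∫ t in x..y, f t := integral_nonneg hxy fun t ht =>
      h0 t ⟨hx.1.trans ht.1, ht.2.trans hy.2⟩
    simp only
    linarith
  · intro x hx
    have := integral_mono_on (g := fun _ => f x) hx.1 (hf.intervalIntegrable (μ := volume) 0 x)
      (by simp) (fun t ht => hm ⟨ht.1, ht.2.trans hx.2⟩ hx ht.2)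
    simpa using this

lemma doublePrimitive_bound {f : ℝ → ℝ} (hf : Continuous f) {c : ℝ}
    (h0 : ∀ x ∈ Set.Icc 0 c, 0 ≤ f x) (hm : MonotoneOn f (Set.Icc 0 c)) :
    (∀ x ∈ Set.Icc 0 c, 0 ≤ doublePrimitive f x) ∧
    MonotoneOn (doublePrimitive f) (Set.Icc 0 c) ∧
    ∀ x ∈ Set.Icc 0 c, doublePrimitive f x ≤ c ^ 2 * f x := by
  obtain ⟨a0, am, ab⟩ := integral_mono_bound hf h0 hm
  obtain ⟨b0, bm, bb⟩ := integral_mono_bound (continuous_primitive_of_continuous hf 0) a0 am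
  refine ⟨b0, bm, fun x hx => (bb x hx).trans ?_⟩
  calc x * ∫ t in (0 : ℝ)..x, f t ≤ x * (x * f x) := mul_le_mul_of_nonneg_left (ab x hx) hx.1
    _ = x ^ 2 * f x := by ring
    _ ≤ c ^ 2 * f x := mul_le_mul_of_nonneg_right (pow_le_pow_left₀ hx.1 hx.2 2) (h0 x hx)

lemma sinKernel_monotoneOn (m : ℕ) : MonotoneOn (sinKernel m) (Set.Icc 0 (π / 2)) := by
  intro x hx y hy hxy
  refine div_le_div_of_nonneg_right (pow_le_pow_left₀ (sin_nonneg_of_mem hx) ?_ _)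
    (wallis_pos m).le
  exact sin_le_sin_of_le_of_le_pi_div_two (by linarith [hx.1, pi_pos]) hy.2 hxy

lemma arcsinTail_succ_nonneg_monotoneOn (r m : ℕ) :
    (∀ x ∈ Set.Icc 0 (π / 2), 0 ≤ arcsinTail r (m + 1) x) ∧
    MonotoneOn (arcsinTail r (m + 1)) (Set.Icc 0 (π / 2)) := by
  induction r with
  | zero =>
    rw [← doublePrimitive_sinKernel]
    obtain ⟨a, b, -⟩ := doublePrimitive_bound (continuous_sinKernel m)
      (fun x hx => sinKernel_nonneg m hx) (sinKernel_monotoneOn m)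
    exact ⟨a, b⟩
  | succ r ih =>
    obtain ⟨a, b, -⟩ := doublePrimitive_bound (continuous_arcsinTail r (m + 1)) ih.1 ih.2
    exact ⟨a, b⟩

lemma arcsinTail_nonneg (r m : ℕ) {x : ℝ} (hx : x ∈ Set.Icc 0 (π / 2)) :
    0 ≤ arcsinTail r m x := by
  cases m with
  | zero => rw [arcsinTail_at_zero]; exact div_nonneg (pow_nonneg hx.1 _) (by positivity)
  | succ m => exact (arcsinTail_succ_nonneg_monotoneOn r m).1 x hx

lemma arcsinTail_succ_le (r m : ℕ) {x : ℝ} (hx : x ∈ Set.Icc 0 (π / 2)) :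
    arcsinTail r (m + 1) x ≤ ((π / 2) ^ 2) ^ r * arcsinTail 0 (m + 1) x := by
  induction r with
  | zero => simp
  | succ r ih =>
    obtain ⟨h0, hm⟩ := arcsinTail_succ_nonneg_monotoneOn r m
    refine ((doublePrimitive_bound (continuous_arcsinTail r (m + 1)) h0 hm).2.2 x hx).trans ?_
    rw [pow_succ' ((π / 2) ^ 2), mul_assoc]
    exact mul_le_mul_of_nonneg_left ih (by positivity)

lemma integral_sinKernel_mul_cos (m : ℕ) (θ : ℝ) :
    ∫ φ in (0 : ℝ)..θ, sinKernel m φ * cos φ =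
      sin θ ^ (2 * m + 2) / ((2 * m + 2) * wallis m) := by
  have hd : ∀ x : ℝ, HasDerivAt (fun θ => sin θ ^ (2 * m + 2) / ((2 * m + 2) * wallis m))
      (sinKernel m x * cos x) x := by
    intro x
    have hw := wallis_pos m
    refine (((hasDerivAt_sin x).pow (2 * m + 2)).div_const ((2 * m + 2) * wallis m)).congr_deriv ?_
    rw [show 2 * m + 2 - 1 = 2 * m + 1 by omega, sinKernel]
    push_cast
    field_simp
  rw [integral_eq_sub_of_hasDerivAt (fun x _ => hd x)]
  · simp
  · exact ((continuous_sinKernel m).mul continuous_cos).intervalIntegrable _ _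

lemma cos_nonneg_of_mem {θ : ℝ} (h : θ ∈ Set.Icc 0 (π / 2)) : 0 ≤ cos θ :=
  cos_nonneg_of_neg_pi_div_two_le_of_le (by linarith [h.1, pi_pos]) h.2

lemma arcsinTail_zero_succ_mul_cos_le (m : ℕ) {θ : ℝ} (h : θ ∈ Set.Icc 0 (π / 2)) :
    arcsinTail 0 (m + 1) θ * cos θ ≤ π / 2 * (1 / ((2 * m + 2) * wallis m)) * sin θ := by
  have hw := wallis_pos m
  have hs := sin_nonneg_of_mem h
  have hc := cos_nonneg_of_mem h
  rw [← doublePrimitive_sinKernel]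
  obtain ⟨a0, am, -⟩ := integral_mono_bound (continuous_sinKernel m)
    (fun x hx => sinKernel_nonneg m hx) (sinKernel_monotoneOn m)
  obtain ⟨-, -, bb⟩ := integral_mono_bound
    (continuous_primitive_of_continuous (continuous_sinKernel m) 0) a0 am
  have h1 : (∫ t in (0 : ℝ)..θ, sinKernel m t) * cos θ ≤
      sin θ ^ (2 * m + 2) / ((2 * m + 2) * wallis m) := by
    rw [← integral_sinKernel_mul_cos, ← intervalIntegral.integral_mul_const]
    refine integral_mono_on h.1
      (((continuous_sinKernel m).mul continuous_const).intervalIntegrable _ _)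
      (((continuous_sinKernel m).mul continuous_cos).intervalIntegrable _ _) fun x hx => ?_
    refine mul_le_mul_of_nonneg_left ?_ (sinKernel_nonneg m ⟨hx.1, hx.2.trans h.2⟩)
    exact cos_le_cos_of_nonneg_of_le_pi hx.1 (by linarith [h.2, pi_pos]) hx.2
  calc doublePrimitive (sinKernel m) θ * cos θ
      ≤ (θ * ∫ t in (0 : ℝ)..θ, sinKernel m t) * cos θ :=
        mul_le_mul_of_nonneg_right (bb θ h) hc
    _ = θ * ((∫ t in (0 : ℝ)..θ, sinKernel m t) * cos θ) := by ring
    _ ≤ π / 2 * (sin θ ^ (2 * m + 2) / ((2 * m + 2) * wallis m)) :=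
        mul_le_mul h.2 h1 (mul_nonneg (a0 θ h) hc) (by positivity)
    _ ≤ π / 2 * (sin θ / ((2 * m + 2) * wallis m)) := by
        gcongr
        exact pow_le_of_le_one hs (sin_le_one θ) (by omega)
    _ = _ := by ring

/-- The integral giving the tail `∑_{m ≤ k₁ < ⋯ < k_s} ∏ 1/(2kᵢ+1)²`. -/
noncomputable def tailTwo : ℕ → ℕ → ℝ
  | 0, _ => 1
  | s + 1, m => ∫ θ in (0 : ℝ)..(π / 2), arcsinTail s m θ

lemma tailTwo_eq_add (s m : ℕ) :
    tailTwo (s + 1) m = 1 / (2 * m + 1) ^ 2 * tailTwo s (m + 1) + tailTwo (s + 1) (m + 1) := by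
  rw [← sub_eq_iff_eq_add, tailTwo, tailTwo,
    ← integral_sub ((continuous_arcsinTail _ _).intervalIntegrable _ _)
    ((continuous_arcsinTail _ _).intervalIntegrable _ _)]
  cases s with
  | zero =>
    simp_rw [arcsinTail_zero_sub]
    rw [intervalIntegral.integral_div, integral_sinKernel, tailTwo, mul_one]
  | succ s =>
    simp_rw [arcsinTail_succ_sub]
    rw [intervalIntegral.integral_div, tailTwo]
    ring

lemma tailTwo_zero_right (s : ℕ) : tailTwo s 0 = (π / 2) ^ (2 * s) / (2 * s).factorial := by
  cases s with
  | zero => simp [tailTwo]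
  | succ s =>
    simp only [tailTwo, arcsinTail_at_zero, intervalIntegral.integral_div, integral_pow]
    rw [show 2 * (s + 1) = 2 * s + 1 + 1 by ring, Nat.factorial_succ (2 * s + 1)]
    push_cast
    field_simp
    simp

lemma tailTwo_nonneg (s m : ℕ) : 0 ≤ tailTwo s m := by
  cases s with
  | zero => simp [tailTwo]
  | succ s =>
    exact integral_nonneg (by positivity) fun x hx => arcsinTail_nonneg s m hx

lemma hasDerivAt_sub_pow_div_factorial (c : ℝ) (n : ℕ) (x : ℝ) :
    HasDerivAt (fun τ : ℝ => (c - τ) ^ (n + 1) / (n + 1).factorial)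
      (-((c - x) ^ n / n.factorial)) x := by
  refine ((((hasDerivAt_id x).const_sub c).pow (n + 1)).div_const
    ((n + 1).factorial : ℝ)).congr_deriv ?_
  rw [Nat.factorial_succ]
  push_cast
  simp only [id]
  field_simp

lemma integral_primitive_mul_pow {f : ℝ → ℝ} (hf : Continuous f) (c : ℝ) (n : ℕ) :
    ∫ τ in (0 : ℝ)..c, (∫ φ in (0 : ℝ)..τ, f φ) * ((c - τ) ^ n / n.factorial) =
      ∫ τ in (0 : ℝ)..c, f τ * ((c - τ) ^ (n + 1) / (n + 1).factorial) := by
  have h := integral_mul_deriv_eq_deriv_mul (a := 0) (b := c)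
    (u := fun τ => ∫ φ in (0 : ℝ)..τ, f φ)
    (fun x _ => (hf.integral_hasStrictDerivAt 0 x).hasDerivAt)
    (fun x _ => hasDerivAt_sub_pow_div_factorial c n x) (hf.intervalIntegrable _ _)
    (by apply Continuous.intervalIntegrable; fun_prop)
  simp only [mul_neg, intervalIntegral.integral_neg] at h
  simp at h
  simpa using h

lemma integral_doublePrimitive_mul_pow {f : ℝ → ℝ} (hf : Continuous f) (c : ℝ) (n : ℕ) :
    ∫ τ in (0 : ℝ)..c, doublePrimitive f τ * ((c - τ) ^ n / n.factorial) =
      ∫ τ in (0 : ℝ)..c, f τ * ((c - τ) ^ (n + 2) / (n + 2).factorial) := by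
  rw [← integral_primitive_mul_pow hf,
    ← integral_primitive_mul_pow (continuous_primitive_of_continuous hf 0)]
  rfl

lemma integral_arcsinTail_mul_pow (s m n : ℕ) (c : ℝ) :
    ∫ τ in (0 : ℝ)..c, arcsinTail s (m + 1) τ * ((c - τ) ^ n / n.factorial) =
      ∫ τ in (0 : ℝ)..c,
        sinKernel m τ * ((c - τ) ^ (n + 2 * s + 2) / (n + 2 * s + 2).factorial) := by
  induction s generalizing n with
  | zero => rw [← doublePrimitive_sinKernel,
      integral_doublePrimitive_mul_pow (continuous_sinKernel m), mul_zero, add_zero]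
  | succ s ih =>
    rw [arcsinTail, integral_doublePrimitive_mul_pow (continuous_arcsinTail _ _), ih]
    rw [show n + 2 + 2 * s + 2 = n + 2 * (s + 1) + 2 by ring]

lemma integral_sinKernel_mul_pow (s m : ℕ) :
    ∫ τ in (0 : ℝ)..(π / 2), sinKernel m τ * ((π / 2 - τ) ^ (2 * s) / (2 * s).factorial) =
      tailTwo s (m + 1) := by
  cases s with
  | zero => simpa [tailTwo] using integral_sinKernel m
  | succ s =>
    have h := integral_arcsinTail_mul_pow s m 0 (π / 2)
    rw [tailTwo, show 2 * (s + 1) = 0 + 2 * s + 2 by ring, ← h]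
    simp

lemma tendsto_tailTwo (s : ℕ) : Tendsto (tailTwo (s + 1)) atTop (𝓝 0) := by
  rw [← tendsto_add_atTop_iff_nat 1]
  set M : ℝ := (π / 2) ^ (2 * s + 1) * (π / 2) with hM
  have hlim := tendsto_inv_mul_wallis.const_mul M
  rw [mul_zero] at hlim
  refine squeeze_zero (fun m => tailTwo_nonneg _ _) (fun m => ?_) hlim
  have h1 := integral_sinKernel_mul_cos m (π / 2)
  rw [sin_pi_div_two, one_pow] at h1
  rw [← integral_sinKernel_mul_pow, ← h1, ← intervalIntegral.integral_const_mul]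
  have hk := continuous_sinKernel m
  refine integral_mono_on (by positivity) (by apply Continuous.intervalIntegrable; fun_prop)
    (by apply Continuous.intervalIntegrable; fun_prop) fun x hx => ?_
  rw [mul_left_comm]
  refine mul_le_mul_of_nonneg_left ?_ (sinKernel_nonneg m hx)
  have h2 : π / 2 - x ≤ π / 2 * cos x := by
    have := mul_le_sin (x := π / 2 - x) (by linarith [hx.2]) (by linarith [hx.1])
    rw [sin_pi_div_two_sub] at this
    calc π / 2 - x = π / 2 * (2 / π * (π / 2 - x)) := by field_simp
      _ ≤ _ := by gcongr
  have h3 : 0 ≤ π / 2 - x := by linarith [hx.2]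
  calc (π / 2 - x) ^ (2 * (s + 1)) / (2 * (s + 1)).factorial ≤ (π / 2 - x) ^ (2 * (s + 1)) :=
        div_le_self (by positivity) (by exact_mod_cast Nat.factorial_pos _)
    _ = (π / 2 - x) ^ (2 * s + 1) * (π / 2 - x) := by ring
    _ ≤ (π / 2) ^ (2 * s + 1) * (π / 2 * cos x) := by
        gcongr
        linarith [hx.1]
    _ = _ := by rw [hM]; ring

/-- The weight against which `arcsinTail` is integrated to produce an entry `3` followed by
`s` entries `2`. -/
noncomputable def cotWeight (s : ℕ) (τ : ℝ) : ℝ :=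
  cos τ / sin τ * ((π / 2 - τ) ^ (2 * s + 1) / (2 * s + 1).factorial)

/-- The integral giving the tail of `t({2}^r, 3, {2}^s)` over indices at least `m`. -/
noncomputable def tailThree (s r m : ℕ) : ℝ :=
  ∫ θ in (0 : ℝ)..(π / 2), arcsinTail r m θ * cotWeight s θ

lemma cotWeight_nonneg (s : ℕ) {x : ℝ} (hx : x ∈ Set.Icc 0 (π / 2)) : 0 ≤ cotWeight s x := by
  have := sin_nonneg_of_mem hx
  have := cos_nonneg_of_mem hx
  have : 0 ≤ π / 2 - x := by linarith [hx.2]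
  unfold cotWeight
  positivity

lemma tailThree_nonneg (s r m : ℕ) : 0 ≤ tailThree s r m :=
  integral_nonneg (by positivity) fun _ hx =>
    mul_nonneg (arcsinTail_nonneg r m hx) (cotWeight_nonneg s hx)

lemma arcsinTail_le_arcsinTail_zero (r m : ℕ) {x : ℝ} (hx : x ∈ Set.Icc 0 (π / 2)) :
    arcsinTail r m x ≤ arcsinTail r 0 x := by
  induction m with
  | zero => rfl
  | succ m ih =>
    refine le_trans ?_ ih
    rw [← sub_nonneg]
    cases r with
    | zero => rw [arcsinTail_zero_sub]; have := sinKernel_nonneg m hx; positivity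
    | succ r => rw [arcsinTail_succ_sub]; have := arcsinTail_nonneg r (m + 1) hx; positivity

lemma le_pi_div_two_mul_sin {x : ℝ} (hx : x ∈ Set.Icc 0 (π / 2)) : x ≤ π / 2 * sin x := by
  have := mul_le_sin hx.1 hx.2
  calc x = π / 2 * (2 / π * x) := by field_simp
    _ ≤ _ := by gcongr

lemma intervalIntegrable_mul_cotWeight (s : ℕ) {f : ℝ → ℝ} (hf : Continuous f) {M : ℝ}
    (h : ∀ x ∈ Set.Icc 0 (π / 2), 0 ≤ f x ∧ f x ≤ M * sin x) :
    IntervalIntegrable (fun x => f x * cotWeight s x) volume 0 (π / 2) := by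
  rw [intervalIntegrable_iff_integrableOn_Icc_of_le (by positivity)]
  refine Measure.integrableOn_of_bounded (M := M * (π / 2) ^ (2 * s + 1)) (by simp) ?_ ?_
  · unfold cotWeight
    exact (hf.measurable.mul ((measurable_cos.div measurable_sin).mul
      (by fun_prop))).aestronglyMeasurable
  · refine (ae_restrict_iff' measurableSet_Icc).2 (Eventually.of_forall fun x hx => ?_)
    obtain ⟨h0, h1⟩ := h x hx
    rw [norm_of_nonneg (mul_nonneg h0 (cotWeight_nonneg s hx))]
    have hs := sin_nonneg_of_mem hx
    have hc := cos_nonneg_of_mem hx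
    have h3 : 0 ≤ π / 2 - x := by linarith [hx.2]
    have hp : (π / 2 - x) ^ (2 * s + 1) / (2 * s + 1).factorial ≤ (π / 2) ^ (2 * s + 1) :=
      (div_le_self (by positivity) (by exact_mod_cast Nat.factorial_pos _)).trans
        (pow_le_pow_left₀ h3 (by linarith [hx.1]) _)
    have hM : 0 ≤ M := by
      have := h (π / 2) ⟨by positivity, le_rfl⟩
      rw [sin_pi_div_two] at this
      linarith
    have hq : f x * (cos x / sin x) ≤ M := by
      rcases hs.eq_or_lt with hs | hs
      · rw [← hs]; simpa using hM
      · rw [← mul_div_assoc, div_le_iff₀ hs]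
        nlinarith [cos_le_one x]
    rw [cotWeight, ← mul_assoc]
    exact mul_le_mul hq hp (by positivity) hM

lemma arcsinTail_le_mul_sin (r m : ℕ) {x : ℝ} (hx : x ∈ Set.Icc 0 (π / 2)) :
    arcsinTail r m x ≤ (π / 2) ^ (2 * r + 1) * sin x := by
  refine (arcsinTail_le_arcsinTail_zero r m hx).trans ?_
  rw [arcsinTail_at_zero]
  have h0 := hx.1
  calc x ^ (2 * r + 1) / (2 * r + 1).factorial ≤ x ^ (2 * r + 1) :=
        div_le_self (by positivity) (by exact_mod_cast Nat.factorial_pos _)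
    _ = x ^ (2 * r) * x := by ring
    _ ≤ (π / 2) ^ (2 * r) * (π / 2 * sin x) := by
        gcongr
        · exact hx.2
        · exact le_pi_div_two_mul_sin hx
    _ = _ := by ring

lemma intervalIntegrable_arcsinTail_mul_cotWeight (s r m : ℕ) :
    IntervalIntegrable (fun x => arcsinTail r m x * cotWeight s x) volume 0 (π / 2) :=
  intervalIntegrable_mul_cotWeight s (continuous_arcsinTail r m) fun _ hx =>
    ⟨arcsinTail_nonneg r m hx, arcsinTail_le_mul_sin r m hx⟩

lemma integral_sinKernel_mul_cotWeight (s m : ℕ) :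
    ∫ τ in (0 : ℝ)..(π / 2), sinKernel m τ * cotWeight s τ =
      1 / (2 * m + 1) * tailTwo s (m + 1) := by
  have hw := wallis_pos m
  have hd : ∀ x : ℝ, HasDerivAt (fun τ => sinKernel m τ / (2 * m + 1))
      (sin x ^ (2 * m) * cos x / wallis m) x := by
    intro x
    refine ((((hasDerivAt_sin x).pow (2 * m + 1)).div_const
      (wallis m)).div_const (2 * m + 1 : ℝ)).congr_deriv ?_
    push_cast
    field_simp
  have h := integral_mul_deriv_eq_deriv_mul (a := 0) (b := π / 2)
    (fun x _ => hasDerivAt_sub_pow_div_factorial (π / 2) (2 * s) x) (fun x _ => hd x)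
    (by apply Continuous.intervalIntegrable; fun_prop)
    (by apply Continuous.intervalIntegrable; fun_prop)
  have e1 : ∫ τ in (0 : ℝ)..(π / 2), sinKernel m τ * cotWeight s τ =
      ∫ x in (0 : ℝ)..(π / 2), (π / 2 - x) ^ (2 * s + 1) / (2 * s + 1).factorial *
        (sin x ^ (2 * m) * cos x / wallis m) := by
    refine integral_congr_ae (Eventually.of_forall fun x hx => ?_)
    rw [Set.uIoc_of_le (by positivity)] at hx
    have : sin x ≠ 0 := (sin_pos_of_pos_of_lt_pi hx.1 (by linarith [hx.2, pi_pos])).ne'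
    rw [sinKernel, cotWeight, pow_succ (sin x)]
    field_simp
  have e2 : sinKernel m 0 = 0 := by simp [sinKernel]
  rw [e1, h, ← integral_sinKernel_mul_pow, ← intervalIntegral.integral_const_mul, e2, sub_self,
    zero_pow (Nat.succ_ne_zero _), zero_div, zero_mul, zero_div, mul_zero, sub_zero, zero_sub,
    ← intervalIntegral.integral_neg]
  congr 1; ext x; ring

lemma tailThree_zero_eq_add (s m : ℕ) :
    tailThree s 0 m =
      1 / (2 * m + 1) ^ 3 * tailTwo s (m + 1) + tailThree s 0 (m + 1) := by
  rw [← sub_eq_iff_eq_add, tailThree, tailThree, ← integral_sub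
    (intervalIntegrable_arcsinTail_mul_cotWeight _ _ _)
    (intervalIntegrable_arcsinTail_mul_cotWeight _ _ _)]
  simp_rw [← sub_mul, arcsinTail_zero_sub, div_mul_eq_mul_div]
  rw [intervalIntegral.integral_div, integral_sinKernel_mul_cotWeight]
  field_simp

lemma tailThree_succ_eq_add (s r m : ℕ) :
    tailThree s (r + 1) m =
      1 / (2 * m + 1) ^ 2 * tailThree s r (m + 1) + tailThree s (r + 1) (m + 1) := by
  rw [← sub_eq_iff_eq_add, tailThree, tailThree, ← integral_sub
    (intervalIntegrable_arcsinTail_mul_cotWeight _ _ _)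
    (intervalIntegrable_arcsinTail_mul_cotWeight _ _ _)]
  simp_rw [← sub_mul, arcsinTail_succ_sub, div_mul_eq_mul_div]
  rw [intervalIntegral.integral_div, tailThree]
  ring

lemma tendsto_tailThree (s r : ℕ) : Tendsto (tailThree s r) atTop (𝓝 0) := by
  rw [← tendsto_add_atTop_iff_nat 1]
  set A : ℝ := ((π / 2) ^ 2) ^ r * (π / 2) * (π / 2) ^ (2 * s + 1) * (π / 2) with hA
  have hlim := tendsto_inv_mul_wallis.const_mul A
  rw [mul_zero] at hlim
  refine squeeze_zero (fun m => tailThree_nonneg _ _ _) (fun m => ?_) hlim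
  set ε : ℝ := 1 / ((2 * m + 2) * wallis m) with hε
  have hε0 : 0 ≤ ε := by have := wallis_pos m; positivity
  have hb : ∀ x ∈ Set.Icc 0 (π / 2), arcsinTail r (m + 1) x * cotWeight s x ≤
      ((π / 2) ^ 2) ^ r * (π / 2 * ε) * (π / 2) ^ (2 * s + 1) := by
    intro x hx
    have hs := sin_nonneg_of_mem hx
    have hc := cos_nonneg_of_mem hx
    have h3 : 0 ≤ π / 2 - x := by linarith [hx.2]
    have hp : (π / 2 - x) ^ (2 * s + 1) / (2 * s + 1).factorial ≤ (π / 2) ^ (2 * s + 1) :=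
      (div_le_self (by positivity) (by exact_mod_cast Nat.factorial_pos _)).trans
        (pow_le_pow_left₀ h3 (by linarith [hx.1]) _)
    have hq : arcsinTail r (m + 1) x * (cos x / sin x) ≤ ((π / 2) ^ 2) ^ r * (π / 2 * ε) := by
      rcases hs.eq_or_lt with hs | hs
      · rw [← hs]; simp; positivity
      · rw [← mul_div_assoc, div_le_iff₀ hs]
        calc arcsinTail r (m + 1) x * cos x
            ≤ ((π / 2) ^ 2) ^ r * arcsinTail 0 (m + 1) x * cos x :=
              mul_le_mul_of_nonneg_right (arcsinTail_succ_le r m hx) hc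
          _ = ((π / 2) ^ 2) ^ r * (arcsinTail 0 (m + 1) x * cos x) := by ring
          _ ≤ ((π / 2) ^ 2) ^ r * (π / 2 * ε * sin x) :=
              mul_le_mul_of_nonneg_left (arcsinTail_zero_succ_mul_cos_le m hx) (by positivity)
          _ = _ := by ring
    rw [cotWeight, ← mul_assoc]
    exact mul_le_mul hq hp (by positivity) (by positivity)
  have := integral_mono_on (by positivity) (intervalIntegrable_arcsinTail_mul_cotWeight s r (m + 1))
    (by simp) hb
  rw [intervalIntegral.integral_const, smul_eq_mul] at this
  refine this.trans_eq ?_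
  rw [hA]; ring

lemma hasSum_of_telescope {f a : ℕ → ℝ} (ha : ∀ m, 0 ≤ a m)
    (hrec : ∀ m, f m = a m + f (m + 1)) (hlim : Tendsto f atTop (𝓝 0)) (m : ℕ) :
    HasSum (fun k => a (k + m)) (f m) := by
  rw [hasSum_iff_tendsto_nat_of_nonneg (fun _ => ha _)]
  have h : ∀ n, ∑ k ∈ range n, a (k + m) = f m - f (n + m) := by
    intro n
    induction n with
    | zero => simp
    | succ n ih =>
      rw [sum_range_succ, ih, hrec (n + m), show n + 1 + m = n + m + 1 by ring]; ring
  simp_rw [h]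
  simpa using ((tendsto_add_atTop_iff_nat m).2 hlim).const_sub (f m)

lemma tsum_ofReal_of_telescope {f a : ℕ → ℝ} (ha : ∀ m, 0 ≤ a m)
    (hrec : ∀ m, f m = a m + f (m + 1)) (hlim : Tendsto f atTop (𝓝 0)) (m : ℕ) :
    ∑' k, (if m ≤ k then ENNReal.ofReal (a k) else 0) = ENNReal.ofReal (f m) := by
  have hsum := hasSum_of_telescope ha hrec hlim m
  have hsplit := (ENNReal.summable
    (f := fun k => if m ≤ k + m then ENNReal.ofReal (a (k + m)) else 0)).sum_add_tsum_nat_add'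
    (k := m) (f := fun k => if m ≤ k then ENNReal.ofReal (a k) else 0)
  have hz : ∑ k ∈ range m, (if m ≤ k then ENNReal.ofReal (a k) else 0) = 0 :=
    sum_eq_zero fun k hk => if_neg (by simpa using hk)
  rw [← hsplit, hz, zero_add, ← hsum.tsum_eq,
    ENNReal.ofReal_tsum_of_nonneg (fun _ => ha _) hsum.summable]
  simp

/-- The multiple t-value with indices shifted to start at `0` and bounded below by `m`,
as an extended nonnegative real. -/
noncomputable def mtvTail (L : List ℕ) (m : ℕ) : ENNReal :=
  open Classical in
  ∑' f : Fin L.length → ℕ, if StrictMono f ∧ ∀ i, m ≤ f i then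
    ∏ i, ENNReal.ofReal (1 / (2 * f i + 1) ^ L.get i) else 0

lemma mtvTail_nil (m : ℕ) : mtvTail [] m = 1 := by
  simp [mtvTail, Subsingleton.strictMono]

lemma mtvTail_cons (a : ℕ) (L : List ℕ) (m : ℕ) :
    mtvTail (a :: L) m =
      ∑' k : ℕ, if m ≤ k then ENNReal.ofReal (1 / (2 * k + 1) ^ a) * mtvTail L (k + 1) else 0 := by
  classical
  unfold mtvTail
  refine ((Fin.consEquiv (fun _ : Fin (L.length + 1) => ℕ)).tsum_eq _).symm.trans ?_
  rw [ENNReal.tsum_prod']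
  congr 1; ext k
  split_ifs with hk
  · rw [← ENNReal.tsum_mul_left]
    congr 1; ext g
    have hiff : (StrictMono (Fin.cons k g : Fin (L.length + 1) → ℕ) ∧
        ∀ i, m ≤ (Fin.cons k g : Fin (L.length + 1) → ℕ) i) ↔
        StrictMono g ∧ ∀ i, k + 1 ≤ g i := by
      rw [Fin.strictMono_cons, Fin.forall_fin_succ]
      simp only [Fin.cons_zero, Fin.cons_succ, hk, true_and]
      exact ⟨fun h => ⟨h.1.2, h.1.1⟩,
        fun h => ⟨⟨h.2, h.1⟩, fun i => hk.trans ((Nat.le_succ k).trans (h.2 i))⟩⟩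
    simp only [Fin.consEquiv, Equiv.coe_fn_mk, List.length_cons, hiff, mul_ite, mul_zero]
    split_ifs
    · rw [Fin.prod_univ_succ]; rfl
    · rfl
  · rw [ENNReal.tsum_eq_zero]
    intro g
    refine if_neg fun h => hk ?_
    simpa [Fin.consEquiv] using h.2 0

lemma MTV_eq_toReal_mtvTail (L : List ℕ) : MTV L = (mtvTail L 0).toReal := by
  classical
  unfold mtvTail MTV
  rw [ENNReal.tsum_toReal_eq fun f => by split_ifs <;> simp [ENNReal.prod_ne_top]]
  refine (tsum_subtype {f : Fin L.length → ℕ+ | StrictMono f} (fun f =>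
      ∏ i : Fin L.length, (1 : ℝ) / ((2 * (f i : ℕ) - 1 : ℕ) : ℝ) ^ L.get i)).trans ?_
  rw [← (Equiv.arrowCongr (Equiv.refl (Fin L.length)) Equiv.pnatEquivNat).tsum_eq]
  congr 1; ext f
  have hiff : StrictMono (fun i => (f i).natPred) ↔ StrictMono f := by
    simp [StrictMono, PNat.natPred_lt_natPred]
  have he : (Equiv.arrowCongr (Equiv.refl (Fin L.length)) Equiv.pnatEquivNat) f =
    fun i => (f i).natPred := rfl
  simp only [Set.indicator, Set.mem_ofPred_eq, he, hiff, zero_le, implies_true, and_true]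
  split_ifs
  · rw [ENNReal.toReal_prod]
    refine prod_congr rfl fun i _ => ?_
    rw [ENNReal.toReal_ofReal (by positivity)]
    congr 2
    have h := (f i).natPred_add_one
    rw [← h]
    simp only [PNat.natPred]
    rw [show 2 * ((f i : ℕ) - 1 + 1) - 1 = 2 * ((f i : ℕ) - 1) + 1 by omega]
    push_cast
    rfl
  · simp

lemma mtvTail_replicate_two (s m : ℕ) :
    mtvTail (List.replicate s 2) m = ENNReal.ofReal (tailTwo s m) := by
  induction s generalizing m with
  | zero => simp [mtvTail_nil, tailTwo]
  | succ s ih =>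
    rw [List.replicate_succ, mtvTail_cons]
    simp_rw [ih]
    rw [← tsum_ofReal_of_telescope (a := fun k : ℕ => 1 / (2 * k + 1) ^ 2 * tailTwo s (k + 1))
      (fun k => mul_nonneg (by positivity) (tailTwo_nonneg _ _)) (tailTwo_eq_add s)
      (tendsto_tailTwo s)]
    simp_rw [ENNReal.ofReal_mul' (tailTwo_nonneg _ _)]

lemma mtvTail_three (r s m : ℕ) :
    mtvTail (List.replicate r 2 ++ 3 :: List.replicate s 2) m =
      ENNReal.ofReal (tailThree s r m) := by
  induction r generalizing m with
  | zero =>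
    rw [List.replicate_zero, List.nil_append, mtvTail_cons]
    simp_rw [mtvTail_replicate_two]
    rw [← tsum_ofReal_of_telescope (a := fun k : ℕ => 1 / (2 * k + 1) ^ 3 * tailTwo s (k + 1))
      (fun k => mul_nonneg (by positivity) (tailTwo_nonneg _ _)) (tailThree_zero_eq_add s)
      (tendsto_tailThree s 0)]
    simp_rw [ENNReal.ofReal_mul' (tailTwo_nonneg _ _)]
  | succ r ih =>
    rw [List.replicate_succ, List.cons_append, mtvTail_cons]
    simp_rw [ih]
    rw [← tsum_ofReal_of_telescope
      (a := fun k : ℕ => 1 / (2 * k + 1) ^ 2 * tailThree s r (k + 1))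
      (fun k => mul_nonneg (by positivity) (tailThree_nonneg _ _ _)) (tailThree_succ_eq_add s r)
      (tendsto_tailThree s (r + 1))]
    simp_rw [ENNReal.ofReal_mul' (tailThree_nonneg _ _ _)]

lemma MTV_replicate_two (s : ℕ) :
    MTV (List.replicate s 2) = (π / 2) ^ (2 * s) / (2 * s).factorial := by
  rw [MTV_eq_toReal_mtvTail, mtvTail_replicate_two, ENNReal.toReal_ofReal (tailTwo_nonneg _ _),
    tailTwo_zero_right]

lemma MTV_replicate_two_three (r s : ℕ) :
    MTV (List.replicate r 2 ++ 3 :: List.replicate s 2) =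
      ∫ θ in (0 : ℝ)..(π / 2), θ ^ (2 * r + 1) / (2 * r + 1).factorial *
        (cos θ / sin θ * ((π / 2 - θ) ^ (2 * s + 1) / (2 * s + 1).factorial)) := by
  rw [MTV_eq_toReal_mtvTail, mtvTail_three, ENNReal.toReal_ofReal (tailThree_nonneg _ _ _),
    tailThree]
  simp_rw [arcsinTail_at_zero, cotWeight]

open Polynomial in
lemma coeff_X_pow_mul_X_add_C_pow_odd (b : ℝ) (i j k : ℕ) (hk : k ≤ i + j + 1) :
    ((2 * k).factorial : ℝ) * (X ^ (2 * i + 1) * (X + C b) ^ (2 * j + 1)).coeff (2 * k) /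
        ((2 * i + 1).factorial * (2 * j + 1).factorial) =
      (2 * k).choose (2 * i + 1) *
        (b ^ (2 * (i + j + 1 - k)) / (2 * (i + j + 1 - k)).factorial) := by
  rw [coeff_X_pow_mul', coeff_X_add_C_pow]
  split_ifs with h
  · obtain ⟨l, rfl⟩ : ∃ l, k = i + 1 + l := ⟨k - i - 1, by omega⟩
    obtain ⟨d, rfl⟩ : ∃ d, j = l + d := ⟨j - l, by omega⟩
    rw [show 2 * (i + 1 + l) - (2 * i + 1) = 2 * l + 1 by omega,
      show 2 * (l + d) + 1 - (2 * l + 1) = 2 * d by omega,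
      show i + (l + d) + 1 - (i + 1 + l) = d by omega,
      Nat.cast_choose ℝ (show 2 * l + 1 ≤ 2 * (l + d) + 1 by omega),
      Nat.cast_choose ℝ h,
      show 2 * (i + 1 + l) - (2 * i + 1) = 2 * l + 1 by omega,
      show 2 * (l + d) + 1 - (2 * l + 1) = 2 * d by omega]
    field_simp
  · rw [Nat.choose_eq_zero_of_lt (by omega)]
    simp

open Polynomial in
lemma eval_iterate_derivative_eq_taylor_coeff (P : ℝ[X]) (a : ℝ) (n : ℕ) :
    (derivative^[n] P).eval a = n.factorial * (taylor a P).coeff n := by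
  rw [taylor_coeff, ← factorial_smul_hasseDeriv]
  simp

open Polynomial in
lemma integral_eval_mul_sin (P : ℝ[X]) {n : ℕ} (hn : n ≠ 0) :
    ∫ x in (0 : ℝ)..(π / 2), P.eval x * sin (2 * n * x) =
      (P.eval 0 - (-1) ^ n * P.eval (π / 2)) / (2 * n) -
      (∫ x in (0 : ℝ)..(π / 2), (derivative (derivative P)).eval x * sin (2 * n * x)) /
        (2 * n) ^ 2 := by
  have hn' : (n : ℝ) ≠ 0 := by exact_mod_cast hn
  have hlin : ∀ x : ℝ, HasDerivAt (fun x : ℝ => 2 * n * x) (2 * n) x := fun x => by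
    simpa using (hasDerivAt_id x).const_mul (2 * n : ℝ)
  have hc : ∀ x : ℝ, HasDerivAt (fun x : ℝ => -cos (2 * n * x) / (2 * n)) (sin (2 * n * x)) x :=
    fun x => by
      refine (((hlin x).cos).neg.div_const (2 * n : ℝ)).congr_deriv ?_
      field_simp
  have hs : ∀ x : ℝ, HasDerivAt (fun x : ℝ => sin (2 * n * x) / (2 * n)) (cos (2 * n * x)) x :=
    fun x => by
      refine (((hlin x).sin).div_const (2 * n : ℝ)).congr_deriv ?_
      field_simp
  have h1 := integral_mul_deriv_eq_deriv_mul (a := 0) (b := π / 2)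
    (fun x _ => P.hasDerivAt x) (fun x _ => hc x)
    (by apply Continuous.intervalIntegrable; fun_prop)
    (by apply Continuous.intervalIntegrable; fun_prop)
  have h2 := integral_mul_deriv_eq_deriv_mul (a := 0) (b := π / 2)
    (fun x _ => (derivative P).hasDerivAt x) (fun x _ => hs x)
    (by apply Continuous.intervalIntegrable; fun_prop)
    (by apply Continuous.intervalIntegrable; fun_prop)
  have hpi : (2 * n * (π / 2) : ℝ) = n * π := by ring
  simp only [hpi, cos_nat_mul_pi, sin_nat_mul_pi, mul_zero, cos_zero, sin_zero, zero_div,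
    sub_zero, zero_sub] at h1 h2
  have e1 : ∫ x in (0 : ℝ)..(π / 2), (derivative P).eval x * (-cos (2 * n * x) / (2 * n)) =
      -(∫ x in (0 : ℝ)..(π / 2), (derivative P).eval x * cos (2 * n * x)) / (2 * n) := by
    rw [← intervalIntegral.integral_neg, ← intervalIntegral.integral_div]
    congr 1; ext x; ring
  have e2 : ∫ x in (0 : ℝ)..(π / 2),
      (derivative (derivative P)).eval x * (sin (2 * n * x) / (2 * n)) =
      (∫ x in (0 : ℝ)..(π / 2), (derivative (derivative P)).eval x * sin (2 * n * x)) /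
        (2 * n) := by
    rw [← intervalIntegral.integral_div]
    congr 1; ext x; ring
  rw [h1, e1, h2, e2]
  field_simp
  ring

open Polynomial in
lemma integral_eval_mul_sin_eq_sum (P : ℝ[X]) (n K : ℕ) (hP : P.natDegree < 2 * K) :
    ∫ x in (0 : ℝ)..(π / 2), P.eval x * sin (2 * n * x) =
      ∑ k ∈ range K, (-1) ^ k * ((derivative^[2 * k] P).eval 0 -
        (-1) ^ n * (derivative^[2 * k] P).eval (π / 2)) / (2 * n) ^ (2 * k + 1) := by
  rcases eq_or_ne n 0 with rfl | hn
  · simp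
  induction K generalizing P with
  | zero => omega
  | succ K ih =>
    have h : ∫ x in (0 : ℝ)..(π / 2), (derivative (derivative P)).eval x * sin (2 * n * x) =
      ∑ k ∈ range K, (-1) ^ k * ((derivative^[2 * k] (derivative (derivative P))).eval 0 -
        (-1) ^ n * (derivative^[2 * k] (derivative (derivative P))).eval (π / 2)) /
          (2 * n) ^ (2 * k + 1) := by
      rcases K with _ | K
      · have : derivative (derivative P) = 0 :=
          iterate_derivative_eq_zero (x := 2) (by omega)
        simp [this]
      · apply ih
        have := natDegree_iterate_derivative P 2
        simp only [Function.iterate_succ, Function.iterate_zero, Function.comp, id] at this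
        omega
    rw [integral_eval_mul_sin P hn, h, sum_range_succ', sum_div]
    have hn' : (n : ℝ) ≠ 0 := by exact_mod_cast hn
    rw [sub_eq_add_neg, ← sum_neg_distrib, add_comm]
    congr 1
    · refine sum_congr rfl fun k _ => ?_
      rw [show 2 * (k + 1) = 2 * k + 1 + 1 by ring, Function.iterate_succ_apply,
        Function.iterate_succ_apply]
      field_simp
      ring
    · simp

lemma tendsto_integral_mul_cos {g : ℝ → ℝ} (hg : ContinuousOn g (Set.Icc 0 (π / 2))) :
    Tendsto (fun N : ℕ => ∫ x in (0 : ℝ)..(π / 2), g x * cos ((2 * N - 1) * x))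
      atTop (𝓝 0) := by
  have hc : (0 : ℝ) ≤ π / 2 := by positivity
  set F : ℝ → ℂ := Set.indicator (Set.Ioc 0 (π / 2)) (fun x => (g x : ℂ)) with hF
  have hFi : Integrable F := by
    rw [hF, integrable_indicator_iff measurableSet_Ioc]
    exact ((hg.integrableOn_Icc).mono_set Set.Ioc_subset_Icc_self).ofReal
  have hw : Tendsto (fun N : ℕ => (2 * (N : ℝ) - 1) / (2 * π)) atTop (cocompact ℝ) := by
    refine Tendsto.mono_right ?_ atTop_le_cocompact
    refine Tendsto.atTop_div_const (by positivity) ?_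
    exact tendsto_atTop_add_const_right _ _
      (tendsto_natCast_atTop_atTop.const_mul_atTop (by norm_num))
  have h := (Real.tendsto_integral_exp_smul_cocompact F).comp hw
  have hre := (Complex.continuous_re.tendsto 0).comp h
  rw [Complex.zero_re] at hre
  refine hre.congr fun N => ?_
  simp only [Function.comp]
  have hi : Integrable fun v : ℝ =>
      Real.fourierChar (-(v * ((2 * (N : ℝ) - 1) / (2 * π)))) • F v := by
    have := (Real.fourierIntegral_convergent_iff (f := F) ((2 * (N : ℝ) - 1) / (2 * π))).2 hFi
    simpa [mul_comm] using this
  rw [← RCLike.re_eq_complex_re, ← integral_re hi, integral_of_le hc,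
    ← MeasureTheory.integral_indicator measurableSet_Ioc]
  congr 1; ext v
  simp only [hF, Set.indicator]
  split_ifs with hv
  · rw [Circle.smul_def, Real.fourierChar_apply, smul_eq_mul, RCLike.re_eq_complex_re,
      Complex.re_mul_ofReal, mul_comm (g v)]
    congr 1
    rw [Complex.exp_ofReal_mul_I_re, ← cos_neg]
    congr 1
    field_simp
  · simp

lemma two_mul_sin_mul_sum_sin (N : ℕ) (x : ℝ) :
    ∑ n ∈ range N, 2 * sin (2 * n * x) * sin x = cos x - cos ((2 * N - 1) * x) := by
  induction N with
  | zero => simp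
  | succ N ih =>
    rw [sum_range_succ, ih]
    have h1 : cos ((2 * N - 1) * x) = cos (2 * N * x - x) := by ring_nf
    have h2 : cos ((2 * (N + 1 : ℕ) - 1) * x) = cos (2 * N * x + x) := by push_cast; ring_nf
    rw [h1, h2, cos_sub, cos_add]
    ring

lemma hasSum_neg_one_pow_div_pow {m : ℕ} (hm : 1 < m) :
    HasSum (fun n : ℕ => (-1 : ℝ) ^ n / n ^ m)
      (-(1 - 1 / 2 ^ (m - 1)) * ∑' n : ℕ, 1 / (n : ℝ) ^ m) := by
  have hs : HasSum (fun n : ℕ => 1 / (n : ℝ) ^ m) (∑' n : ℕ, 1 / (n : ℝ) ^ m) :=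
    (Real.summable_one_div_nat_pow.2 hm).hasSum
  set Z := ∑' n : ℕ, 1 / (n : ℝ) ^ m
  have he : HasSum (fun n : ℕ => (1 + (-1 : ℝ) ^ n) / n ^ m) (1 / 2 ^ (m - 1) * Z) := by
    rw [← (mul_right_injective₀ (two_ne_zero' ℕ)).hasSum_iff]
    · refine Eq.subst (motive := fun f => HasSum f _) (funext fun n => ?_)
        (hs.mul_left (1 / 2 ^ (m - 1)))
      obtain ⟨l, rfl⟩ : ∃ l, m = l + 1 := ⟨m - 1, by omega⟩
      simp only [Function.comp, (even_two_mul n).neg_one_pow, Nat.add_sub_cancel]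
      push_cast
      rw [mul_pow, pow_succ (2 : ℝ)]
      field_simp
      ring
    · intro n hn
      have : Odd n := by
        rw [← Nat.not_even_iff_odd]
        rintro ⟨j, rfl⟩
        exact hn ⟨j, by simp; ring⟩
      simp [this.neg_one_pow]
  rw [show -(1 - 1 / 2 ^ (m - 1)) * Z = 1 / 2 ^ (m - 1) * Z - Z by ring]
  exact Eq.subst (motive := fun f => HasSum f _) (funext fun n => by ring) (he.sub hs)

open Polynomial in
lemma integral_mul_cot_eq_sum (Q : ℝ[X]) (K : ℕ) (hQ : (X * Q).natDegree < 2 * K)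
    (h0 : Q.eval (π / 2) = 0) :
    ∫ x in (0 : ℝ)..(π / 2), (X * Q).eval x * (cos x / sin x) =
      ∑ k ∈ Icc 1 (K - 1), (-1) ^ k * ((derivative^[2 * k] (X * Q)).eval 0 +
        (1 - 1 / 2 ^ (2 * k)) * (derivative^[2 * k] (X * Q)).eval (π / 2)) *
        (1 / 2 ^ (2 * k)) * ∑' n : ℕ, 1 / (n : ℝ) ^ (2 * k + 1) := by
  have hc : (0 : ℝ) ≤ π / 2 := by positivity
  set P := X * Q with hP
  have hsinc : ∀ x ∈ Set.Icc 0 (π / 2), sinc x ≠ 0 := by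
    intro x hx
    rcases hx.1.eq_or_lt with rfl | h
    · simp
    · rw [sinc_of_ne_zero h.ne']
      exact div_ne_zero (sin_pos_of_pos_of_lt_pi h (by linarith [hx.2, pi_pos])).ne' h.ne'
  have hg : ContinuousOn (fun x => Q.eval x / sinc x) (Set.Icc 0 (π / 2)) :=
    Q.continuous.continuousOn.div continuous_sinc.continuousOn hsinc
  have hpart : ∀ N : ℕ, ∑ n ∈ range N, 2 * ∫ x in (0 : ℝ)..(π / 2), P.eval x * sin (2 * n * x) =
      (∫ x in (0 : ℝ)..(π / 2), P.eval x * (cos x / sin x)) -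
        ∫ x in (0 : ℝ)..(π / 2), Q.eval x / sinc x * cos ((2 * N - 1) * x) := by
    intro N
    have hi : ∀ f : ℝ → ℝ, Continuous f →
        IntervalIntegrable (fun x => Q.eval x / sinc x * f x) volume 0 (π / 2) := fun f hf => by
      apply ContinuousOn.intervalIntegrable
      rw [Set.uIcc_of_le hc]
      exact hg.mul hf.continuousOn
    have e1 : ∫ x in (0 : ℝ)..(π / 2), P.eval x * (cos x / sin x) =
        ∫ x in (0 : ℝ)..(π / 2), Q.eval x / sinc x * cos x := by
      refine integral_congr_ae (Eventually.of_forall fun x hx => ?_)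
      rw [Set.uIoc_of_le hc] at hx
      have hs : sin x ≠ 0 := (sin_pos_of_pos_of_lt_pi hx.1 (by linarith [hx.2, pi_pos])).ne'
      have hx0 := hx.1.ne'
      rw [sinc_of_ne_zero hx0, hP, eval_mul, eval_X]
      field_simp
    simp_rw [← intervalIntegral.integral_const_mul]
    rw [e1, ← integral_sub (hi _ continuous_cos) (hi _ (by fun_prop)),
      ← intervalIntegral.integral_finsetSum]
    · refine integral_congr_ae (Eventually.of_forall fun x hx => ?_)
      rw [Set.uIoc_of_le hc] at hx
      have hs : sin x ≠ 0 := (sin_pos_of_pos_of_lt_pi hx.1 (by linarith [hx.2, pi_pos])).ne'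
      have hx0 := hx.1.ne'
      rw [← mul_sub, ← two_mul_sin_mul_sum_sin, mul_sum]
      refine sum_congr rfl fun n _ => ?_
      rw [sinc_of_ne_zero hx0, hP, eval_mul, eval_X]
      field_simp
    · intro n _
      apply Continuous.intervalIntegrable
      fun_prop
  have hlim : Tendsto (fun N : ℕ => ∑ n ∈ range N,
      2 * ∫ x in (0 : ℝ)..(π / 2), P.eval x * sin (2 * n * x)) atTop
      (𝓝 (∫ x in (0 : ℝ)..(π / 2), P.eval x * (cos x / sin x))) := by
    simp_rw [hpart]
    simpa using (tendsto_integral_mul_cos hg).const_sub _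
  refine tendsto_nhds_unique hlim (HasSum.tendsto_sum_nat ?_)
  have hterm : ∀ n : ℕ, 2 * ∫ x in (0 : ℝ)..(π / 2), P.eval x * sin (2 * n * x) =
      ∑ k ∈ Icc 1 (K - 1), ((-1) ^ k * (derivative^[2 * k] P).eval 0 * (1 / 2 ^ (2 * k)) *
        (1 / (n : ℝ) ^ (2 * k + 1)) - (-1) ^ k * (derivative^[2 * k] P).eval (π / 2) *
        (1 / 2 ^ (2 * k)) * ((-1) ^ n / (n : ℝ) ^ (2 * k + 1))) := by
    intro n
    have hK : range K = insert 0 (Icc 1 (K - 1)) := by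
      ext k; simp only [mem_range, mem_insert, mem_Icc]; omega
    rw [integral_eval_mul_sin_eq_sum P n K hQ, hK, sum_insert (by simp), mul_add, mul_sum]
    have hz : (derivative^[2 * 0] P).eval 0 -
        (-1) ^ n * (derivative^[2 * 0] P).eval (π / 2) = 0 := by
      simp [hP, h0]
    rw [hz, mul_zero, zero_div, mul_zero, zero_add]
    refine sum_congr rfl fun k _ => ?_
    rw [mul_pow, pow_succ (2 : ℝ)]
    rcases eq_or_ne n 0 with rfl | hn
    · simp
    field_simp
  simp_rw [hterm]
  refine hasSum_sum fun k hk => ?_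
  have hk1 : 1 < 2 * k + 1 := by have := (mem_Icc.1 hk).1; omega
  have hs := (Real.summable_one_div_nat_pow.2 hk1).hasSum
  have h := (hs.mul_left ((-1) ^ k * (derivative^[2 * k] P).eval 0 * (1 / 2 ^ (2 * k)))).sub
    ((hasSum_neg_one_pow_div_pow hk1).mul_left
      ((-1) ^ k * (derivative^[2 * k] P).eval (π / 2) * (1 / 2 ^ (2 * k))))
  rw [Nat.add_sub_cancel] at h
  refine Eq.subst (motive := HasSum _) ?_ h
  ring

open Polynomial in
lemma integral_pow_mul_cot_mul_pow (r s : ℕ) :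
    ∫ θ in (0 : ℝ)..(π / 2), θ ^ (2 * r + 1) / (2 * r + 1).factorial *
        (cos θ / sin θ * ((π / 2 - θ) ^ (2 * s + 1) / (2 * s + 1).factorial)) =
      ∑ k ∈ Icc 1 (r + s + 1), (-1) ^ (k - 1) *
        ((2 * k).choose (2 * r + 1) + (1 - 1 / 2 ^ (2 * k)) * (2 * k).choose (2 * s + 1)) *
        (1 / 2 ^ (2 * k)) * (∑' n : ℕ, 1 / (n : ℝ) ^ (2 * k + 1)) *
        ((π / 2) ^ (2 * (r + s + 1 - k)) / (2 * (r + s + 1 - k)).factorial) := by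
  set κ : ℝ := (2 * r + 1).factorial * (2 * s + 1).factorial with hκ
  set Q : ℝ[X] := C (-1 / κ) * (X ^ (2 * r) * (X + C (-(π / 2))) ^ (2 * s + 1)) with hQ
  have hP : X * Q = C (-1 / κ) * (X ^ (2 * r + 1) * (X + C (-(π / 2))) ^ (2 * s + 1)) := by
    rw [hQ]; ring
  have hdeg : (X * Q).natDegree < 2 * (r + s + 2) := by
    rw [hP]
    have h1 : (X ^ (2 * r + 1) * (X + C (-(π / 2))) ^ (2 * s + 1) : ℝ[X]).natDegree ≤
        (2 * r + 1) + (2 * s + 1) := by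
      compute_degree
    have := (natDegree_C_mul_le (-1 / κ)
      (X ^ (2 * r + 1) * (X + C (-(π / 2))) ^ (2 * s + 1))).trans h1
    omega
  have h := integral_mul_cot_eq_sum Q (r + s + 2) hdeg (by simp [hQ])
  have h_int : ∫ θ in (0 : ℝ)..(π / 2), θ ^ (2 * r + 1) / (2 * r + 1).factorial *
      (cos θ / sin θ * ((π / 2 - θ) ^ (2 * s + 1) / (2 * s + 1).factorial)) =
      ∫ x in (0 : ℝ)..(π / 2), (X * Q).eval x * (cos x / sin x) := by
    congr 1; ext x
    rw [hP]
    simp only [eval_mul, eval_C, eval_pow, eval_add, eval_X]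
    rw [show x + -(π / 2) = -(π / 2 - x) by ring, (odd_two_mul_add_one s).neg_pow, hκ]
    field_simp
  rw [h_int, h]
  refine sum_congr rfl fun k hk => ?_
  obtain ⟨hk1, hk2⟩ := mem_Icc.1 hk
  have hk3 : k ≤ r + s + 1 := by omega
  have d0 : (derivative^[2 * k] (X * Q)).eval 0 = -((2 * k).choose (2 * r + 1) *
      ((π / 2) ^ (2 * (r + s + 1 - k)) / (2 * (r + s + 1 - k)).factorial)) := by
    have e := coeff_X_pow_mul_X_add_C_pow_odd (-(π / 2)) r s k hk3
    rw [(even_two_mul _).neg_pow] at e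
    rw [eval_iterate_derivative_eq_taylor_coeff, taylor_zero, hP, coeff_C_mul, ← e]
    ring
  have d1 : (derivative^[2 * k] (X * Q)).eval (π / 2) = -((2 * k).choose (2 * s + 1) *
      ((π / 2) ^ (2 * (r + s + 1 - k)) / (2 * (r + s + 1 - k)).factorial)) := by
    have e := coeff_X_pow_mul_X_add_C_pow_odd (π / 2) s r k (by omega)
    rw [show s + r + 1 - k = r + s + 1 - k by omega] at e
    have ht : taylor (π / 2) (X * Q) =
        C (-1 / κ) * (X ^ (2 * s + 1) * (X + C (π / 2)) ^ (2 * r + 1)) := by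
      rw [hP]
      simp only [taylor_mul, taylor_C, taylor_pow, taylor_X, map_add]
      rw [add_assoc, ← C_add, add_neg_cancel, C_0, add_zero]
      ring
    rw [eval_iterate_derivative_eq_taylor_coeff, ht, coeff_C_mul, ← e, hκ]
    ring
  rw [d0, d1]
  obtain ⟨l, rfl⟩ : ∃ l, k = l + 1 := ⟨k - 1, by omega⟩
  rw [Nat.add_sub_cancel, pow_succ (-1 : ℝ)]
  ring

theorem stmt_11 (r s : ℕ) :
    (MTV (List.replicate r 2 ++ 3 :: List.replicate s 2) : ℂ) =
      ∑ k ∈ Finset.Icc 1 (r + s + 1),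
        (-1) ^ (k - 1) *
          ((Nat.choose (2 * k) (2 * r + 1) : ℂ) +
            (1 - 1 / 2 ^ (2 * k)) * (Nat.choose (2 * k) (2 * s + 1) : ℂ)) *
          (1 / 2 ^ (2 * k)) * riemannZeta (2 * k + 1) *
          (MTV (List.replicate (r + s + 1 - k) 2) : ℂ) := by
  rw [MTV_replicate_two_three, integral_pow_mul_cot_mul_pow, Complex.ofReal_sum]
  refine sum_congr rfl fun k hk => ?_
  have hk1 : 1 < 2 * k + 1 := by have := (mem_Icc.1 hk).1; omega
  have hz : riemannZeta (2 * k + 1) = ((∑' n : ℕ, 1 / (n : ℝ) ^ (2 * k + 1) : ℝ) : ℂ) := by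
    have := zeta_nat_eq_tsum_of_gt_one hk1
    push_cast at this ⊢
    exact this
  rw [hz, MTV_replicate_two]
  push_cast
  ring
end

section
/- For nonnegative integers r and s, the series A_{r,s} := ∑_{n=0}^{∞} ζ(2n)/((2n+2r+2)(2n+2r+3)···(2n+2r+2s+3)·2^{2n}) equals (1/(2·(2s+1)!)) · [∑_{k=1}^{r+s+1} (-1)^k(4^k-1)ζ(2k+1)(2k)!/(2π)^{2k} · C(2r+2, 2k-2s-1) - ∑_{k=1}^{r+s+1} (2k)!(-1)^k ζ(2k+1)/π^{2k} · C(2s+1, 2k-2r-2)]. -/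
/-- Binomial coefficient `C(n, k)` with integer lower index, zero when `k < 0`. -/
def chooseInt (n : ℕ) (k : ℤ) : ℤ := if 0 ≤ k then (n.choose k.toNat : ℤ) else 0

open Filter Topology MeasureTheory Polynomial

lemma HasSum.of_eq {f g : ℕ → ℂ} {a b : ℂ} (h : HasSum f a) (hfg : ∀ n, f n = g n)
    (hab : a = b) : HasSum g b :=
  hab ▸ funext hfg ▸ h

lemma hasSum_one_div_succ_pow {m : ℕ} (hm : 1 < m) :
    HasSum (fun k : ℕ ↦ 1 / ((k : ℂ) + 1) ^ m) (riemannZeta m) := by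
  have hs : Summable fun k : ℕ ↦ 1 / (k : ℂ) ^ m := by
    have h := (Complex.summable_one_div_nat_cpow (p := m)).mpr (by simpa using hm)
    simpa only [Complex.cpow_natCast] using h
  rw [zeta_nat_eq_tsum_of_gt_one hm]
  have h := (hasSum_nat_add_iff' (f := fun k : ℕ ↦ 1 / (k : ℂ) ^ m) 1).mpr hs.hasSum
  simpa [show m ≠ 0 by omega] using h

lemma hasSum_neg_one_pow_div_succ_pow {m : ℕ} (hm : 1 < m) :
    HasSum (fun k : ℕ ↦ (-1) ^ (k + 1) / ((k : ℂ) + 1) ^ m)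
      ((2 / 2 ^ m - 1) * riemannZeta m) := by
  have h := hasSum_one_div_succ_pow hm
  have hodd : HasSum (fun k : ℕ ↦ 1 / (((2 * k + 1 : ℕ) : ℂ) + 1) ^ m)
      (1 / 2 ^ m * riemannZeta m) := by
    refine HasSum.of_eq ((h.mul_left (1 / 2 ^ m : ℂ))) (fun k ↦ ?_) rfl
    rw [div_mul_div_comm, ← mul_pow]
    push_cast
    ring
  have heven : Summable (fun k : ℕ ↦ 1 / (((2 * k : ℕ) : ℂ) + 1) ^ m) :=
    h.summable.comp_injective (i := fun k : ℕ ↦ 2 * k) fun a b hab ↦ by simpa using hab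
  have heo := (HasSum.even_add_odd (f := fun k : ℕ ↦ 1 / ((k : ℂ) + 1) ^ m)
    heven.hasSum hodd).unique h
  have hneg : HasSum (fun k : ℕ ↦ (-1) ^ (2 * k + 1) / (((2 * k : ℕ) : ℂ) + 1) ^ m)
      (-∑' k : ℕ, 1 / (((2 * k : ℕ) : ℂ) + 1) ^ m) := by
    refine HasSum.of_eq (heven.hasSum.neg) (fun k ↦ ?_) rfl
    rw [pow_succ, pow_mul]
    simp [neg_div]
  have hpos : HasSum (fun k : ℕ ↦ (-1) ^ (2 * k + 1 + 1) / (((2 * k + 1 : ℕ) : ℂ) + 1) ^ m)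
      (1 / 2 ^ m * riemannZeta m) := by
    refine HasSum.of_eq (hodd) (fun k ↦ ?_) rfl
    rw [pow_succ, pow_succ, pow_mul]
    simp
  have hall := HasSum.even_add_odd (f := fun k : ℕ ↦ (-1) ^ (k + 1) / ((k : ℂ) + 1) ^ m)
    hneg hpos
  rwa [show -∑' k : ℕ, 1 / (((2 * k : ℕ) : ℂ) + 1) ^ m + 1 / 2 ^ m * riemannZeta m =
    (2 / 2 ^ m - 1) * riemannZeta m by linear_combination -heo] at hall

lemma mem_integerComplement_of_norm_lt_one {z : ℂ} (hz : z ≠ 0) (hz1 : ‖z‖ < 1) :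
    z ∈ Complex.integerComplement := by
  rintro ⟨n, rfl⟩
  rw [Complex.norm_intCast] at hz1
  have : |n| < 1 := by exact_mod_cast hz1
  exact hz (by simp [Int.abs_lt_one_iff.mp this])

lemma hasSum_riemannZeta_two_mul_pow {z : ℂ} (hz : z ≠ 0) (hz1 : ‖z‖ < 1) :
    HasSum (fun n : ℕ ↦ riemannZeta (2 * n) * z ^ (2 * n))
      (-(Real.pi * z / 2) * Complex.cot (Real.pi * z)) := by
  have hzZ := mem_integerComplement_of_norm_lt_one hz hz1
  have hz2 : ‖z‖ ^ 2 < 1 := by nlinarith [norm_nonneg z]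
  let f : ℕ × ℕ → ℂ := fun p ↦ (z ^ 2 / ((p.2 : ℂ) + 1) ^ 2) ^ (p.1 + 1)
  have hgeom : Summable fun n : ℕ ↦ (‖z‖ ^ 2) ^ (n + 1) :=
    (summable_nat_add_iff 1).mpr (summable_geometric_of_lt_one (by positivity) hz2)
  have hsq : Summable fun k : ℕ ↦ 1 / ((k : ℝ) + 1) ^ 2 := by
    have h := (summable_nat_add_iff 1).mpr
      ((Real.summable_one_div_nat_pow (p := 2)).mpr (by norm_num))
    simpa using h
  have hnorm (k : ℕ) : ‖(k : ℂ) + 1‖ = (k : ℝ) + 1 := by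
    exact_mod_cast Complex.norm_natCast (k + 1)
  have hf : Summable f := by
    refine Summable.of_norm_bounded
      (hgeom.mul_of_nonneg hsq (fun n ↦ by positivity) (fun n ↦ by positivity)) fun p ↦ ?_
    simp only [f, norm_pow, norm_div, hnorm, div_pow, div_eq_mul_one_div ((‖z‖ ^ 2) ^ (p.1 + 1))]
    gcongr
    exact le_self_pow₀ (one_le_pow₀ (by simp)) (by simp)
  have hrow (n : ℕ) : HasSum (fun k ↦ f (n, k))
      (riemannZeta (2 * (n + 1 : ℕ)) * z ^ (2 * (n + 1))) := by
    have h := (hasSum_one_div_succ_pow (m := 2 * (n + 1)) (by omega)).mul_right (z ^ (2 * (n + 1)))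
    push_cast at h ⊢
    refine HasSum.of_eq (h) (fun k ↦ ?_) rfl
    simp only [f, div_pow, ← pow_mul]
    ring
  have hcol (k : ℕ) : HasSum (fun n ↦ f (n, k))
      (-(z / 2) * (1 / (z - (k + 1)) + 1 / (z + (k + 1)))) := by
    have hk : (k : ℂ) + 1 ≠ 0 := by exact_mod_cast k.succ_ne_zero
    have hq : ‖z ^ 2 / ((k : ℂ) + 1) ^ 2‖ < 1 := by
      rw [norm_div, norm_pow, norm_pow, hnorm, div_lt_one (by positivity)]
      exact hz2.trans_le (one_le_pow₀ (by simp))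
    have h1 := Complex.integerComplement_add_ne_zero hzZ (k + 1)
    have h2 := Complex.integerComplement_add_ne_zero hzZ (-(k + 1))
    push_cast at h1 h2
    have h2' : z - (k + 1) ≠ 0 := by simpa [sub_eq_add_neg, add_comm] using h2
    have h3 : ((k : ℂ) + 1) ^ 2 - z ^ 2 ≠ 0 := by
      rw [show ((k : ℂ) + 1) ^ 2 - z ^ 2 = -((z - (k + 1)) * (z + (k + 1))) by ring]
      exact neg_ne_zero.mpr (mul_ne_zero h2' h1)
    refine HasSum.of_eq ((hasSum_geometric_of_norm_lt_one hq).mul_left (z ^ 2 / ((k : ℂ) + 1) ^ 2))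
      (fun n ↦ ?_) ?_
    · simp only [f, pow_succ']
    · have h4 : 1 - z ^ 2 / ((k : ℂ) + 1) ^ 2 = (((k : ℂ) + 1) ^ 2 - z ^ 2) / (k + 1) ^ 2 := by
        field_simp
      rw [h4, inv_div, div_mul_div_comm, div_add_div _ _ h2' h1, ← sub_eq_zero]
      field_simp
      ring
  have htotal := hf.hasSum.prod_fiberwise hrow
  have htotal' := ((Equiv.prodComm ℕ ℕ).hasSum_iff.mpr hf.hasSum).prod_fiberwise hcol
  have hcot := ((summable_cotTerm hzZ).hasSum.mul_left (-(z / 2)))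
  change HasSum _ (-(z / 2) * ∑' n : ℕ, (1 / (z - (n + 1)) + 1 / (z + (n + 1)))) at hcot
  rw [← cot_series_rep' hzZ] at hcot
  rw [htotal'.unique hcot] at htotal
  rw [← hasSum_nat_add_iff' 1]
  refine HasSum.of_eq htotal (fun n ↦ rfl) ?_
  simp only [Finset.sum_range_one, Nat.cast_zero, mul_zero, riemannZeta_zero, pow_zero]
  field_simp
  ring

lemma integral_pow_mul_one_sub_pow (m q : ℕ) :
    ∫ t in (0 : ℝ)..1, (t : ℂ) ^ m * (1 - (t : ℂ)) ^ q =
      q.factorial / ∏ i ∈ Finset.Icc (m + 1) (m + q + 1), (i : ℂ) := by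
  have h := Complex.betaIntegral_eval_nat_add_one_right (u := (m : ℂ) + 1) (by simp; positivity) q
  simp only [Complex.betaIntegral, add_sub_cancel_right, Complex.cpow_natCast] at h
  rw [h, ← Finset.Ico_add_one_right_eq_Icc, Finset.prod_Ico_eq_prod_range]
  congr 1
  refine Finset.prod_congr (by congr 1; omega) fun i _ ↦ ?_
  push_cast
  ring

lemma two_mul_sin_half_mul_sum_sin (θ : ℂ) (N : ℕ) :
    2 * Complex.sin (θ / 2) * ∑ k ∈ Finset.range N, Complex.sin ((k + 1) * θ) =
      Complex.cos (θ / 2) - Complex.cos ((N + 1 / 2) * θ) := by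
  induction N with
  | zero => simp [div_eq_inv_mul]
  | succ N ih =>
    rw [Finset.sum_range_succ, mul_add, ih]
    have h1 : Complex.cos ((N + 1 / 2) * θ) =
        Complex.cos ((N + 1) * θ - θ / 2) := by ring_nf
    have h2 : Complex.cos (((N + 1 : ℕ) + 1 / 2) * θ) =
        Complex.cos ((N + 1) * θ + θ / 2) := by push_cast; ring_nf
    rw [h1, h2, Complex.cos_sub, Complex.cos_add]
    ring

lemma tendsto_integral_mul_cos_zero {g : ℝ → ℂ} (hg : IntervalIntegrable g volume 0 1) :
    Tendsto (fun N : ℕ ↦ ∫ t in (0 : ℝ)..1, g t * Complex.cos ((N + 1 / 2) * (Real.pi * t)))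
      atTop (𝓝 0) := by
  have hRL := Real.tendsto_integral_exp_smul_cocompact ((Set.Ioc (0 : ℝ) 1).indicator g)
  have hterm (w : ℝ) : ∫ v, Real.fourierChar (-(v * w)) • (Set.Ioc (0 : ℝ) 1).indicator g v =
      ∫ t in (0 : ℝ)..1, g t * Complex.exp (-(2 * Real.pi * w * t) * Complex.I) := by
    rw [intervalIntegral.integral_of_le zero_le_one, ← integral_indicator measurableSet_Ioc]
    congr 1 with v
    by_cases hv : v ∈ Set.Ioc (0 : ℝ) 1
    · simp only [Set.indicator_of_mem hv, Circle.smul_def, Real.fourierChar_apply, smul_eq_mul]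
      rw [mul_comm]
      push_cast
      ring_nf
    · simp [Set.indicator_of_notMem hv]
  simp only [hterm] at hRL
  have hw : Tendsto (fun N : ℕ ↦ ((N : ℝ) + 1 / 2) / 2) atTop atTop :=
    (tendsto_atTop_add_const_right _ _ tendsto_natCast_atTop_atTop).atTop_div_const two_pos
  have hpos := hRL.comp (hw.mono_right atTop_le_cocompact)
  have hneg := hRL.comp ((tendsto_neg_atTop_atBot.comp hw).mono_right atBot_le_cocompact)
  have h := (hpos.add hneg).div_const 2
  rw [add_zero, zero_div] at h
  refine h.congr fun N ↦ ?_
  simp only [Function.comp]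
  rw [← intervalIntegral.integral_add, ← intervalIntegral.integral_div]
  · congr 1 with t
    rw [Complex.cos]
    push_cast
    ring_nf
  · exact hg.mul_continuousOn (by fun_prop)
  · exact hg.mul_continuousOn (by fun_prop)

lemma intervalIntegrable_eval_div_sin (Q : ℂ[X]) :
    IntervalIntegrable (fun t : ℝ ↦ (X * Q).eval (t : ℂ) / Complex.sin (Real.pi * t / 2))
      volume 0 1 := by
  have hb : IntervalIntegrable (fun t : ℝ ↦ (t : ℂ) / Complex.sin (Real.pi * t / 2))
      volume 0 1 := by
    refine (intervalIntegrable_const (c := (1 : ℝ))).mono_fun ?_ ?_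
    · refine Measurable.aestronglyMeasurable ?_
      fun_prop
    · rw [Set.uIoc_of_le zero_le_one]
      refine (ae_restrict_iff' measurableSet_Ioc).mpr (.of_forall fun t ht ↦ ?_)
      have hsin : t ≤ Real.sin (Real.pi * t / 2) := by
        have h := Real.mul_le_sin (x := Real.pi * t / 2)
          (by have := Real.pi_pos; have := ht.1; positivity)
          (by nlinarith [Real.pi_pos, ht.2])
        have h' : 2 / Real.pi * (Real.pi * t / 2) = t := by field_simp
        linarith
      have hcast : (t : ℂ) / Complex.sin (Real.pi * t / 2) =
          ((t / Real.sin (Real.pi * t / 2) : ℝ) : ℂ) := by push_cast; rfl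
      beta_reduce
      rw [hcast, Complex.norm_real, norm_one, Real.norm_of_nonneg
        (div_nonneg ht.1.le (ht.1.le.trans hsin))]
      exact div_le_one_of_le₀ hsin (ht.1.le.trans hsin)
  have h := hb.mul_continuousOn (g := fun t : ℝ ↦ Q.eval (t : ℂ)) (by fun_prop)
  refine h.congr ?_
  intro t _
  simp only [eval_mul, eval_X]
  ring

lemma tendsto_sum_integral_eval_mul_sin (Q : ℂ[X]) :
    Tendsto (fun N : ℕ ↦ ∑ k ∈ Finset.range N,
        ∫ t in (0 : ℝ)..1, (X * Q).eval (t : ℂ) * Complex.sin ((k + 1) * (Real.pi * t))) atTop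
      (𝓝 ((∫ t in (0 : ℝ)..1, (X * Q).eval (t : ℂ) * Complex.cot (Real.pi * t / 2)) / 2)) := by
  have hg := intervalIntegrable_eval_div_sin Q
  have h := ((tendsto_integral_mul_cos_zero hg).const_sub
    (∫ t in (0 : ℝ)..1, (X * Q).eval (t : ℂ) * Complex.cot (Real.pi * t / 2))).div_const 2
  rw [sub_zero] at h
  refine h.congr fun N ↦ ?_
  have hcot : IntervalIntegrable
      (fun t : ℝ ↦ (X * Q).eval (t : ℂ) * Complex.cot (Real.pi * t / 2)) volume 0 1 := by
    convert hg.mul_continuousOn (g := fun t : ℝ ↦ Complex.cos (Real.pi * t / 2)) (by fun_prop)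
      using 2 with t
    rw [Complex.cot]
    ring
  rw [← intervalIntegral.integral_finsetSum fun k _ ↦
      Continuous.intervalIntegrable (by fun_prop) _ _,
    ← intervalIntegral.integral_sub hcot (hg.mul_continuousOn (by fun_prop)),
    ← intervalIntegral.integral_div]
  refine intervalIntegral.integral_congr fun t ht ↦ ?_
  rw [Set.uIcc_of_le zero_le_one] at ht
  rcases ht.1.eq_or_lt with rfl | ht0
  · simp
  have hsin : Complex.sin (Real.pi * t / 2) ≠ 0 := by
    have : 0 < Real.sin (Real.pi * t / 2) := Real.sin_pos_of_pos_of_lt_pi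
      (by have := Real.pi_pos; positivity) (by nlinarith [Real.pi_pos, ht.2])
    exact_mod_cast Complex.ofReal_ne_zero.mpr this.ne'
  have hsum := two_mul_sin_half_mul_sum_sin (Real.pi * t) N
  simp only [← Finset.mul_sum, Complex.cot]
  generalize ∑ k ∈ Finset.range N, Complex.sin ((k + 1) * (Real.pi * (t : ℂ))) = S at hsum ⊢
  generalize Complex.cos ((N + 1 / 2) * (Real.pi * (t : ℂ))) = c at hsum ⊢
  field_simp
  linear_combination -(X * Q).eval (t : ℂ) * hsum

lemma integral_eval_mul_sin_s12 (Q : ℂ[X]) (k : ℕ) :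
    ∫ t in (0 : ℝ)..1, Q.eval (t : ℂ) * Complex.sin ((k + 1) * (Real.pi * t)) =
      (Q.eval 0 - (-1) ^ (k + 1) * Q.eval 1) / (Real.pi * (k + 1)) -
        1 / (Real.pi * (k + 1)) ^ 2 *
          ∫ t in (0 : ℝ)..1, (derivative^[2] Q).eval (t : ℂ) *
            Complex.sin ((k + 1) * (Real.pi * t)) := by
  set w : ℂ := Real.pi * (k + 1) with hw
  have hw0 : w ≠ 0 := mul_ne_zero (by exact_mod_cast Real.pi_ne_zero)
    (by exact_mod_cast k.succ_ne_zero)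
  have hwt (t : ℂ) : ((k : ℂ) + 1) * (Real.pi * t) = w * t := by rw [hw]; ring
  simp only [hwt]
  have hderiv (t : ℝ) : HasDerivAt
      (fun t : ℝ ↦ -(Q.eval (t : ℂ) * Complex.cos (w * t)) / w +
        (derivative Q).eval (t : ℂ) * Complex.sin (w * t) / w ^ 2)
      (Q.eval (t : ℂ) * Complex.sin (w * t) +
        1 / w ^ 2 * ((derivative^[2] Q).eval (t : ℂ) * Complex.sin (w * t))) t := by
    have hlin : HasDerivAt (fun z : ℂ ↦ w * z) w t := by
      simpa using (hasDerivAt_id (t : ℂ)).const_mul w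
    have h := (((Q.hasDerivAt (t : ℂ)).mul hlin.ccos).neg.div_const w).add
      ((((derivative Q).hasDerivAt (t : ℂ)).mul hlin.csin).div_const (w ^ 2))
    refine HasDerivAt.congr_deriv h.comp_ofReal ?_
    rw [show derivative^[2] Q = derivative (derivative Q) from rfl]
    field_simp
    ring
  have hint := intervalIntegral.integral_eq_sub_of_hasDerivAt (a := 0) (b := 1)
    (fun t _ ↦ hderiv t) (Continuous.intervalIntegrable (by fun_prop) _ _)
  rw [intervalIntegral.integral_add (Continuous.intervalIntegrable (by fun_prop) _ _)
    (Continuous.intervalIntegrable (by fun_prop) _ _), intervalIntegral.integral_const_mul] at hint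
  have hsin : Complex.sin w = 0 := by
    have h := Complex.sin_nat_mul_pi (k + 1)
    push_cast at h
    rwa [mul_comm] at h
  have hcos : Complex.cos w = (-1) ^ (k + 1) := by
    have h := congrArg Complex.ofReal (Real.cos_nat_mul_pi (k + 1))
    push_cast at h
    rwa [mul_comm] at h
  simp only [Complex.ofReal_zero, Complex.ofReal_one, mul_zero, mul_one, hsin, hcos,
    Complex.sin_zero, Complex.cos_zero] at hint
  linear_combination hint

lemma integral_eval_mul_sin_eq_sum_s12 {Q : ℂ[X]} {M : ℕ} (hQ : Q.natDegree < 2 * M) (k : ℕ) :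
    ∫ t in (0 : ℝ)..1, Q.eval (t : ℂ) * Complex.sin ((k + 1) * (Real.pi * t)) =
      ∑ j ∈ Finset.range M, (-1) ^ j *
        ((derivative^[2 * j] Q).eval 0 - (-1) ^ (k + 1) * (derivative^[2 * j] Q).eval 1) /
          (Real.pi * (k + 1)) ^ (2 * j + 1) := by
  have hstep (N : ℕ) :
      ∫ t in (0 : ℝ)..1, Q.eval (t : ℂ) * Complex.sin ((k + 1) * (Real.pi * t)) =
        ∑ j ∈ Finset.range N, (-1) ^ j *
          ((derivative^[2 * j] Q).eval 0 - (-1) ^ (k + 1) * (derivative^[2 * j] Q).eval 1) /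
            (Real.pi * (k + 1)) ^ (2 * j + 1) +
        (-1) ^ N / (Real.pi * (k + 1)) ^ (2 * N) *
          ∫ t in (0 : ℝ)..1, (derivative^[2 * N] Q).eval (t : ℂ) *
            Complex.sin ((k + 1) * (Real.pi * t)) := by
    induction N with
    | zero => simp
    | succ N ih =>
      rw [ih, Finset.sum_range_succ, integral_eval_mul_sin_s12, ← Function.iterate_add_apply,
        show 2 + 2 * N = 2 * (N + 1) by ring]
      have hw0 : (Real.pi * ((k : ℂ) + 1)) ≠ 0 := mul_ne_zero
        (by exact_mod_cast Real.pi_ne_zero) (by exact_mod_cast k.succ_ne_zero)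
      generalize (Real.pi * ((k : ℂ) + 1)) = w at hw0
      field_simp
      ring
  rw [hstep M, iterate_derivative_eq_zero hQ]
  simp

lemma eval_iterate_derivative_eq_factorial_mul_taylor_coeff (P : ℂ[X]) (a : ℂ) (n : ℕ) :
    (derivative^[n] P).eval a = n.factorial * (taylor a P).coeff n := by
  rw [taylor_coeff, ← factorial_smul_hasseDeriv]
  simp

lemma chooseInt_two_mul_sub (n j a : ℕ) (d : ℤ) (hd : d = 2 * j - a) :
    (chooseInt n d : ℂ) = if a ≤ 2 * j then (n.choose (2 * j - a) : ℂ) else 0 := by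
  subst hd
  unfold chooseInt
  by_cases h : a ≤ 2 * j
  · rw [if_pos h, if_pos (by omega), show ((2 : ℤ) * j - a).toNat = 2 * j - a by omega]
    norm_cast
  · rw [if_neg h, if_neg (by omega), Int.cast_zero]

lemma eval_zero_iterate_derivative (r s j : ℕ) :
    (derivative^[2 * j] (X * (X ^ (2 * r + 1) * (1 - X) ^ (2 * s + 1)) : ℂ[X])).eval 0 =
      (2 * j).factorial * (chooseInt (2 * s + 1) (2 * j - 2 * r - 2) : ℂ) := by
  rw [eval_iterate_derivative_eq_factorial_mul_taylor_coeff, taylor_zero, ← mul_assoc,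
    ← pow_succ', coeff_X_pow_mul', chooseInt_two_mul_sub _ j (2 * r + 1 + 1) _ (by push_cast; ring)]
  congr 1
  split_ifs with h
  · have hcomp : ((1 - X) ^ (2 * s + 1) : ℂ[X]) = ((1 + X) ^ (2 * s + 1)).comp (C (-1) * X) := by
      simp [sub_eq_add_neg]
    rw [hcomp, comp_C_mul_X_coeff, coeff_one_add_X_pow, Even.neg_one_pow ⟨j - (r + 1), by omega⟩,
      mul_one]
  · rfl

lemma eval_one_iterate_derivative (r s j : ℕ) :
    (derivative^[2 * j] (X * (X ^ (2 * r + 1) * (1 - X) ^ (2 * s + 1)) : ℂ[X])).eval 1 =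
      -((2 * j).factorial * (chooseInt (2 * r + 2) (2 * j - 2 * s - 1) : ℂ)) := by
  have htaylor : taylor 1 (X * (X ^ (2 * r + 1) * (1 - X) ^ (2 * s + 1)) : ℂ[X]) =
      -(X ^ (2 * s + 1) * (X + 1) ^ (2 * r + 2)) := by
    have hX : (1 : ℂ[X]) - (X + 1) = -X := by ring
    simp only [taylor_apply, mul_comp, pow_comp, sub_comp, X_comp, one_comp, map_one, hX,
      Odd.neg_pow ⟨s, rfl⟩]
    ring
  rw [eval_iterate_derivative_eq_factorial_mul_taylor_coeff, htaylor, coeff_neg,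
    coeff_X_pow_mul', chooseInt_two_mul_sub _ j (2 * s + 1) _ (by push_cast; ring), mul_neg]
  simp only [coeff_X_add_one_pow]

lemma hasSum_riemannZeta_two_mul_div_prod (r s : ℕ) :
    HasSum (fun n : ℕ ↦ riemannZeta (2 * n) /
        ((∏ i ∈ Finset.Icc (2 * n + 2 * r + 2) (2 * n + 2 * r + 2 * s + 3), (i : ℂ))
          * 2 ^ (2 * n)))
      (-(Real.pi / (4 * (2 * s + 1).factorial)) * ∫ t in (0 : ℝ)..1,
        (X * (X ^ (2 * r + 1) * (1 - X) ^ (2 * s + 1)) : ℂ[X]).eval (t : ℂ) *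
          Complex.cot (Real.pi * t / 2)) := by
  have hhalf := hasSum_riemannZeta_two_mul_pow (z := 1 / 2) (by norm_num) (by norm_num)
  have h := intervalIntegral.hasSum_integral_of_dominated_convergence (μ := volume) (a := 0) (b := 1)
    (F := fun (n : ℕ) (t : ℝ) ↦ riemannZeta (2 * n) * ((t : ℂ) / 2) ^ (2 * n) *
      ((t : ℂ) ^ (2 * r + 1) * (1 - (t : ℂ)) ^ (2 * s + 1)))
    (f := fun t : ℝ ↦ -(Real.pi * ((t : ℂ) / 2) / 2) * Complex.cot (Real.pi * ((t : ℂ) / 2)) *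
      ((t : ℂ) ^ (2 * r + 1) * (1 - (t : ℂ)) ^ (2 * s + 1)))
    (fun n _ ↦ ‖riemannZeta (2 * n) * (1 / 2 : ℂ) ^ (2 * n)‖)
    (fun n ↦ Continuous.aestronglyMeasurable (by fun_prop))
    (fun n ↦ .of_forall fun t ht ↦ ?_) (.of_forall fun _ _ ↦ hhalf.summable.norm)
    intervalIntegrable_const (.of_forall fun t ht ↦ ?_)
  · refine (h.mul_left (1 / ((2 * s + 1).factorial : ℂ))).of_eq (fun n ↦ ?_) ?_
    · have hbeta := integral_pow_mul_one_sub_pow (2 * n + 2 * r + 1) (2 * s + 1)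
      rw [show 2 * n + 2 * r + 1 + (2 * s + 1) + 1 = 2 * n + 2 * r + 2 * s + 3 by ring] at hbeta
      have hint : ∫ t in (0 : ℝ)..1, riemannZeta (2 * n) * ((t : ℂ) / 2) ^ (2 * n) *
          ((t : ℂ) ^ (2 * r + 1) * (1 - (t : ℂ)) ^ (2 * s + 1)) =
          riemannZeta (2 * n) / 2 ^ (2 * n) *
            ∫ t in (0 : ℝ)..1, (t : ℂ) ^ (2 * n + 2 * r + 1) * (1 - (t : ℂ)) ^ (2 * s + 1) := by
        rw [← intervalIntegral.integral_const_mul]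
        congr 1 with t
        rw [div_pow]
        ring
      have hfac : ((2 * s + 1).factorial : ℂ) ≠ 0 := by
        exact_mod_cast (2 * s + 1).factorial_ne_zero
      rw [hint, hbeta]
      field_simp
    · rw [← intervalIntegral.integral_const_mul, ← intervalIntegral.integral_const_mul]
      congr 1 with t
      simp only [eval_mul, eval_pow, eval_sub, eval_X, eval_one, mul_div_assoc]
      ring
  · rw [Set.uIoc_of_le zero_le_one] at ht
    have ht' : ‖(t : ℂ)‖ ≤ 1 := by
      rw [Complex.norm_real, Real.norm_of_nonneg ht.1.le]
      exact ht.2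
    have ht'' : ‖1 - (t : ℂ)‖ ≤ 1 := by
      have hcast : 1 - (t : ℂ) = ((1 - t : ℝ) : ℂ) := by push_cast; rfl
      rw [hcast, Complex.norm_real, Real.norm_of_nonneg (by linarith [ht.2])]
      linarith [ht.1]
    simp only [norm_mul, norm_pow, norm_div, norm_one]
    calc _ ≤ ‖riemannZeta (2 * n)‖ * (1 / ‖(2 : ℂ)‖) ^ (2 * n) *
          (1 ^ (2 * r + 1) * 1 ^ (2 * s + 1)) := by gcongr
      _ = _ := by simp
  · rw [Set.uIoc_of_le zero_le_one] at ht
    refine HasSum.mul_right _ (hasSum_riemannZeta_two_mul_pow ?_ ?_)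
    · exact div_ne_zero (Complex.ofReal_ne_zero.mpr ht.1.ne') two_ne_zero
    · rw [norm_div, Complex.norm_real, Real.norm_of_nonneg ht.1.le]
      norm_num
      linarith [ht.2]

lemma integral_eval_mul_cot_eq_sum {Q : ℂ[X]} {M : ℕ} (hdeg : (X * Q).natDegree < 2 * (M + 1))
    (h1 : Q.eval 1 = 0) :
    (∫ t in (0 : ℝ)..1, (X * Q).eval (t : ℂ) * Complex.cot (Real.pi * t / 2)) / 2 =
      ∑ j ∈ Finset.Icc 1 M, (-1) ^ j / (Real.pi : ℂ) ^ (2 * j + 1) * riemannZeta (2 * j + 1) *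
        ((derivative^[2 * j] (X * Q)).eval 0 -
          (2 / 2 ^ (2 * j + 1) - 1) * (derivative^[2 * j] (X * Q)).eval 1) := by
  refine tendsto_nhds_unique (tendsto_sum_integral_eval_mul_sin Q) (HasSum.tendsto_sum_nat ?_)
  have hsum : HasSum (fun k : ℕ ↦ ∑ j ∈ Finset.Icc 1 M, (-1) ^ j / (Real.pi : ℂ) ^ (2 * j + 1) *
      ((derivative^[2 * j] (X * Q)).eval 0 * (1 / ((k : ℂ) + 1) ^ (2 * j + 1)) -
        (derivative^[2 * j] (X * Q)).eval 1 * ((-1) ^ (k + 1) / ((k : ℂ) + 1) ^ (2 * j + 1))))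
      _ := hasSum_sum fun j hj ↦ by
    have hj1 : 1 < 2 * j + 1 := by have := (Finset.mem_Icc.mp hj).1; omega
    exact (((hasSum_one_div_succ_pow hj1).mul_left _).sub
      ((hasSum_neg_one_pow_div_succ_pow hj1).mul_left _)).mul_left _
  refine hsum.of_eq (fun k ↦ ?_) (Finset.sum_congr rfl fun j _ ↦ ?_)
  · rw [integral_eval_mul_sin_eq_sum_s12 hdeg, Finset.range_eq_Ico,
      Finset.sum_eq_sum_Ico_succ_bot (Nat.succ_pos M), ← Finset.Ico_add_one_right_eq_Icc]
    simp only [mul_zero, Function.iterate_zero, id, eval_mul, eval_X, zero_mul, h1, sub_zero,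
      zero_div, zero_add]
    refine Finset.sum_congr rfl fun j _ ↦ ?_
    rw [mul_pow]
    field_simp
  · push_cast
    ring

theorem stmt_12 (r s : ℕ) :
    ∑' n : ℕ, riemannZeta (2 * n) /
        ((∏ i ∈ Finset.Icc (2 * n + 2 * r + 2) (2 * n + 2 * r + 2 * s + 3), (i : ℂ))
          * 2 ^ (2 * n)) =
      (1 / (2 * (Nat.factorial (2 * s + 1) : ℂ))) *
        (∑ k ∈ Finset.Icc 1 (r + s + 1),
            (-1) ^ k * (4 ^ k - 1) * riemannZeta (2 * k + 1) * (Nat.factorial (2 * k) : ℂ) /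
              (2 * (Real.pi : ℂ)) ^ (2 * k) *
              (chooseInt (2 * r + 2) (2 * k - 2 * s - 1) : ℂ)
          - ∑ k ∈ Finset.Icc 1 (r + s + 1),
              (Nat.factorial (2 * k) : ℂ) * (-1) ^ k * riemannZeta (2 * k + 1) /
                (Real.pi : ℂ) ^ (2 * k) *
                (chooseInt (2 * s + 1) (2 * k - 2 * r - 2) : ℂ)) := by
  have hdeg : (X * (X ^ (2 * r + 1) * (1 - X) ^ (2 * s + 1)) : ℂ[X]).natDegree <
      2 * (r + s + 1 + 1) := by
    have hle : (X * (X ^ (2 * r + 1) * (1 - X) ^ (2 * s + 1)) : ℂ[X]).natDegree ≤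
        1 + ((2 * r + 1) * 1 + (2 * s + 1) * 1) := by
      compute_degree
      omega
    omega
  have hint := integral_eval_mul_cot_eq_sum hdeg (by simp)
  simp only [eval_zero_iterate_derivative, eval_one_iterate_derivative] at hint
  have hfac : ((2 * s + 1).factorial : ℂ) ≠ 0 := by
    exact_mod_cast (2 * s + 1).factorial_ne_zero
  have hpi : (Real.pi : ℂ) ≠ 0 := by exact_mod_cast Real.pi_ne_zero
  rw [(hasSum_riemannZeta_two_mul_div_prod r s).tsum_eq, ← Finset.sum_sub_distrib,
    (div_eq_iff two_ne_zero).mp hint, Finset.sum_mul, Finset.mul_sum, Finset.mul_sum]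
  refine Finset.sum_congr rfl fun k _ ↦ ?_
  rw [show (4 : ℂ) ^ k = 2 ^ (2 * k) by rw [pow_mul]; norm_num, mul_pow, pow_succ, pow_succ]
  field_simp
  ring
end
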